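/- arXiv:1708.01375 — 11 statements merged into one kernel-verified Lean document; each statement's English description precedes it below -/
import Mathlib

section
/- Let n ≥ 1, let y₀ ∈ ℂ, and for each j = 1, …, n let κ_j ∈ ℂ and let f_j ∈ ℂ[x₁, …, x_{j−1}] be a polynomial in the first j−1 variables (f₁ a constant). Then for every initial point p = (p₁, …, p_n) ∈ ℂⁿ there exists a unique differentiable map γ = (γ₁, …, γ_n) : ℂ → ℂⁿ with γ(0) = p satisfying the triangular system of ODEs γ_j′(c) = κ_j y₀ γ_j(c) + f_j(γ₁(c), …, γ_{j−1}(c)) for all c ∈ ℂ and all j = 1, …, n; moreover every component γ_j is a quasi-polynomial. -/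
noncomputable section

/-- A quasi-polynomial is a function of the form `c ↦ ∑ₖ qₖ(c) e^{aₖ c}`
with `qₖ` polynomials and `aₖ` complex numbers. -/
def IsQuasiPolynomial (γ : ℂ → ℂ) : Prop :=
  ∃ (N : ℕ) (q : Fin N → Polynomial ℂ) (a : Fin N → ℂ),
    ∀ c : ℂ, γ c = ∑ k, (q k).eval c * Complex.exp (a k * c)

theorem IsQuasiPolynomial.of_fintype {ι : Type} [Fintype ι] {γ : ℂ → ℂ} (q : ι → Polynomial ℂ)
    (a : ι → ℂ) (h : ∀ c : ℂ, γ c = ∑ k, (q k).eval c * Complex.exp (a k * c)) :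
    IsQuasiPolynomial γ := by
  refine ⟨Fintype.card ι, fun k => q ((Fintype.equivFin ι).symm k),
    fun k => a ((Fintype.equivFin ι).symm k), fun c => ?_⟩
  rw [h c]
  exact (Equiv.sum_comp (Fintype.equivFin ι).symm
    (fun k => (q k).eval c * Complex.exp (a k * c))).symm

theorem IsQuasiPolynomial.single (q : Polynomial ℂ) (a : ℂ) :
    IsQuasiPolynomial fun c => q.eval c * Complex.exp (a * c) :=
  IsQuasiPolynomial.of_fintype (ι := Unit) (fun _ => q) (fun _ => a) (by simp)

theorem IsQuasiPolynomial.const (z : ℂ) : IsQuasiPolynomial fun _ => z := by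
  simpa using IsQuasiPolynomial.single (Polynomial.C z) 0

theorem IsQuasiPolynomial.add {u v : ℂ → ℂ} (hu : IsQuasiPolynomial u)
    (hv : IsQuasiPolynomial v) : IsQuasiPolynomial fun c => u c + v c := by
  obtain ⟨N, q, a, h⟩ := hu
  obtain ⟨M, r, b, k⟩ := hv
  refine IsQuasiPolynomial.of_fintype (ι := Fin N ⊕ Fin M) (Sum.elim q r) (Sum.elim a b) ?_
  intro c
  simp [h, k]

theorem IsQuasiPolynomial.mul {u v : ℂ → ℂ} (hu : IsQuasiPolynomial u)
    (hv : IsQuasiPolynomial v) : IsQuasiPolynomial fun c => u c * v c := by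
  obtain ⟨N, q, a, h⟩ := hu
  obtain ⟨M, r, b, k⟩ := hv
  refine IsQuasiPolynomial.of_fintype (ι := Fin N × Fin M) (fun x => q x.1 * r x.2)
    (fun x => a x.1 + b x.2) ?_
  intro c
  simp only [h, k, Finset.sum_mul_sum, Fintype.sum_prod_type]
  refine Finset.sum_congr rfl fun i _ => Finset.sum_congr rfl fun j _ => ?_
  rw [Polynomial.eval_mul, add_mul, Complex.exp_add]
  ring

theorem IsQuasiPolynomial.mvEval {n : ℕ} {γ : ℂ → Fin n → ℂ}
    (h : ∀ j, IsQuasiPolynomial fun c => γ c j) (f : MvPolynomial (Fin n) ℂ) :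
    IsQuasiPolynomial fun c => MvPolynomial.eval (γ c) f := by
  induction f using MvPolynomial.induction_on with
  | C z => simpa using IsQuasiPolynomial.const z
  | add p q hp hq => simpa using hp.add hq
  | mul_X p i hp => simpa using hp.mul (h i)

theorem exists_poly_antideriv (b : ℂ) (q : Polynomial ℂ) :
    ∃ r : Polynomial ℂ, Polynomial.derivative r + Polynomial.C b * r = q := by
  induction q using Polynomial.induction_on' with
  | add p q hp hq =>
    obtain ⟨r, hr⟩ := hp
    obtain ⟨s, hs⟩ := hq
    refine ⟨r + s, ?_⟩
    rw [Polynomial.derivative_add, ← hr, ← hs]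
    ring
  | monomial n z =>
    by_cases hb : b = 0
    · refine ⟨Polynomial.monomial (n + 1) (z / (n + 1)), ?_⟩
      have : (n : ℂ) + 1 ≠ 0 := Nat.cast_add_one_ne_zero n
      subst hb
      simp only [Polynomial.derivative_monomial, map_zero, zero_mul, add_zero]
      congr 1
      push_cast
      field_simp
    · induction n generalizing z with
      | zero =>
        refine ⟨Polynomial.C (z / b), ?_⟩
        rw [Polynomial.derivative_C, zero_add, ← Polynomial.C_mul, mul_div_cancel₀ _ hb]
        rfl
      | succ n ih =>
        obtain ⟨r, hr⟩ := ih (z / b * (n + 1))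
        refine ⟨Polynomial.monomial (n + 1) (z / b) - r, ?_⟩
        rw [Polynomial.derivative_sub, mul_sub, Polynomial.derivative_monomial,
          Polynomial.C_mul_monomial, mul_div_cancel₀ _ hb]
        push_cast
        rw [← hr]
        ring

theorem IsQuasiPolynomial.exists_antideriv {g : ℂ → ℂ} (hg : IsQuasiPolynomial g) :
    ∃ u : ℂ → ℂ, IsQuasiPolynomial u ∧ ∀ c, HasDerivAt u (g c) c := by
  obtain ⟨N, q, a, h⟩ := hg
  choose r hr using fun k => exists_poly_antideriv (a k) (q k)
  refine ⟨fun c => ∑ k, (r k).eval c * Complex.exp (a k * c), ⟨N, r, a, fun _ => rfl⟩, ?_⟩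
  intro c
  rw [h c]
  refine HasDerivAt.fun_sum fun k _ => ?_
  have h1 : HasDerivAt (fun c => Complex.exp (a k * c)) (Complex.exp (a k * c) * (a k * 1)) c :=
    ((hasDerivAt_id c).const_mul (a k)).cexp
  refine (((r k).hasDerivAt c).fun_mul h1).congr_deriv ?_
  rw [← hr k]
  simp only [Polynomial.eval_add, Polynomial.eval_mul, Polynomial.eval_C]
  ring

theorem hasDerivAt_cexp_mul (a c : ℂ) :
    HasDerivAt (fun c => Complex.exp (a * c)) (Complex.exp (a * c) * a) c := by
  simpa using ((hasDerivAt_id c).const_mul a).cexp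

theorem IsQuasiPolynomial.exists_solution {g : ℂ → ℂ} (hg : IsQuasiPolynomial g) (a p : ℂ) :
    ∃ u : ℂ → ℂ, IsQuasiPolynomial u ∧ u 0 = p ∧ ∀ c, HasDerivAt u (a * u c + g c) c := by
  have he : ∀ b : ℂ, IsQuasiPolynomial fun c => Complex.exp (b * c) := fun b => by
    simpa using IsQuasiPolynomial.single 1 b
  obtain ⟨v, hv, hd⟩ := ((he (-a)).mul hg).exists_antideriv
  refine ⟨fun c => Complex.exp (a * c) * (v c + (p - v 0)),
    (he a).mul (hv.add (IsQuasiPolynomial.const _)), by simp, fun c => ?_⟩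
  refine ((hasDerivAt_cexp_mul a c).fun_mul ((hd c).add_const (p - v 0))).congr_deriv ?_
  have : Complex.exp (a * c) * Complex.exp (-a * c) = 1 := by
    rw [← Complex.exp_add]; simp
  linear_combination g c * this

theorem scalar_unique {a : ℂ} {g u w : ℂ → ℂ} (h0 : u 0 = w 0)
    (hu : ∀ c, HasDerivAt u (a * u c + g c) c) (hw : ∀ c, HasDerivAt w (a * w c + g c) c) :
    ∀ c, u c = w c := by
  have hd : ∀ c, HasDerivAt (fun c => Complex.exp (-a * c) * (u c - w c)) 0 c := fun c => by
    refine ((hasDerivAt_cexp_mul (-a) c).fun_mul ((hu c).fun_sub (hw c))).congr_deriv ?_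
    ring
  intro c
  have := is_const_of_deriv_eq_zero (fun c => (hd c).differentiableAt) (fun c => (hd c).deriv) c 0
  simp only [h0, sub_self, mul_zero, mul_eq_zero, Complex.exp_ne_zero, false_or] at this
  exact sub_eq_zero.mp this

theorem eval_congr_supported {n : ℕ} {m : ℕ} {f : MvPolynomial (Fin n) ℂ}
    (hf : f ∈ MvPolynomial.supported ℂ {i : Fin n | (i : ℕ) < m}) {x y : Fin n → ℂ}
    (h : ∀ i : Fin n, (i : ℕ) < m → x i = y i) :
    MvPolynomial.eval x f = MvPolynomial.eval y f := by
  rw [MvPolynomial.mem_supported] at hf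
  exact MvPolynomial.eval₂Hom_congr' rfl (fun i hi _ => h i (hf hi)) rfl

theorem exists_partial_solution (n : ℕ) (y₀ : ℂ) (κ : Fin n → ℂ)
    (f : Fin n → MvPolynomial (Fin n) ℂ)
    (hf : ∀ j : Fin n, f j ∈ MvPolynomial.supported ℂ {i : Fin n | (i : ℕ) < (j : ℕ)})
    (p : Fin n → ℂ) (m : ℕ) :
    ∃ γ : ℂ → Fin n → ℂ, γ 0 = p ∧ (∀ j, IsQuasiPolynomial fun c => γ c j) ∧
      ∀ (c : ℂ) (j : Fin n), (j : ℕ) < m → HasDerivAt (fun t => γ t j)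
        (κ j * y₀ * γ c j + MvPolynomial.eval (γ c) (f j)) c := by
  induction m with
  | zero => exact ⟨fun _ => p, rfl, fun j => IsQuasiPolynomial.const _, fun _ _ h => by omega⟩
  | succ m ih =>
    obtain ⟨γ, h0, hq, hd⟩ := ih
    by_cases hm : m < n
    · obtain ⟨u, huq, hu0, hud⟩ :=
        (IsQuasiPolynomial.mvEval hq (f ⟨m, hm⟩)).exists_solution (κ ⟨m, hm⟩ * y₀) (p ⟨m, hm⟩)
      have hev : ∀ (c : ℂ) (j : Fin n), (j : ℕ) ≤ m →
          MvPolynomial.eval (Function.update (γ c) ⟨m, hm⟩ (u c)) (f j)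
            = MvPolynomial.eval (γ c) (f j) := fun c j hj => by
        refine eval_congr_supported (hf j) fun i hi => ?_
        rw [Function.update_of_ne]
        intro h
        subst h
        simp at hi
        omega
      refine ⟨fun c => Function.update (γ c) ⟨m, hm⟩ (u c), ?_, fun j => ?_, fun c j hj => ?_⟩
      · simp only [hu0, h0, Function.update_eq_self]
      · by_cases hjm : j = ⟨m, hm⟩
        · subst hjm; simpa using huq
        · simpa [Function.update_of_ne hjm] using hq j
      · simp only [hev c j (by omega)]
        by_cases hjm : j = ⟨m, hm⟩
        · subst hjm; simpa using hud c
        · have : (j : ℕ) ≠ m := fun h => hjm (Fin.ext h)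
          simpa [Function.update_of_ne hjm] using hd c j (by omega)
    · exact ⟨γ, h0, hq, fun c j _ => hd c j (by have := j.2; omega)⟩

theorem system_unique (n : ℕ) (y₀ : ℂ) (κ : Fin n → ℂ)
    (f : Fin n → MvPolynomial (Fin n) ℂ)
    (hf : ∀ j : Fin n, f j ∈ MvPolynomial.supported ℂ {i : Fin n | (i : ℕ) < (j : ℕ)})
    (γ δ : ℂ → Fin n → ℂ) (h0 : γ 0 = δ 0)
    (hγ : ∀ (c : ℂ) (j : Fin n), HasDerivAt (fun t => γ t j)
        (κ j * y₀ * γ c j + MvPolynomial.eval (γ c) (f j)) c)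
    (hδ : ∀ (c : ℂ) (j : Fin n), HasDerivAt (fun t => δ t j)
        (κ j * y₀ * δ c j + MvPolynomial.eval (δ c) (f j)) c) : γ = δ := by
  have key : ∀ (m : ℕ) (j : Fin n), (j : ℕ) = m → ∀ c, γ c j = δ c j := by
    intro m
    induction m using Nat.strong_induction_on with
    | _ m ih =>
      intro j hj
      refine scalar_unique (a := κ j * y₀) (g := fun c => MvPolynomial.eval (γ c) (f j))
        (u := fun c => γ c j) (w := fun c => δ c j) (by simp only [h0]) (fun c => hγ c j)
        (fun c => ?_)
      have := eval_congr_supported (hf j) (x := γ c) (y := δ c)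
        (fun i hi => ih i (by omega) i rfl c)
      simp only [this]
      exact hδ c j
  funext c j
  exact key j j rfl c

/-- The triangular system of ODEs `γⱼ'(c) = κⱼ y₀ γⱼ(c) + fⱼ(γ₁(c), …, γ_{j-1}(c))`,
where each `fⱼ` is a polynomial in the first `j-1` variables, has, for every initial
point `p ∈ ℂⁿ`, a unique solution `γ : ℂ → ℂⁿ` with `γ(0) = p`, and all of the
components of this solution are quasi-polynomials. -/
theorem stmt_0 (n : ℕ) (hn : 1 ≤ n) (y₀ : ℂ) (κ : Fin n → ℂ)
    (f : Fin n → MvPolynomial (Fin n) ℂ)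
    (hf : ∀ j : Fin n, f j ∈ MvPolynomial.supported ℂ {i : Fin n | (i : ℕ) < (j : ℕ)})
    (p : Fin n → ℂ) :
    (∃! γ : ℂ → Fin n → ℂ, γ 0 = p ∧
      ∀ (c : ℂ) (j : Fin n), HasDerivAt (fun t => γ t j)
        (κ j * y₀ * γ c j + MvPolynomial.eval (γ c) (f j)) c) ∧
    (∀ γ : ℂ → Fin n → ℂ,
      (γ 0 = p ∧
        ∀ (c : ℂ) (j : Fin n), HasDerivAt (fun t => γ t j)
          (κ j * y₀ * γ c j + MvPolynomial.eval (γ c) (f j)) c) →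
      ∀ j : Fin n, IsQuasiPolynomial fun c => γ c j) := by
  obtain ⟨γ, h0, hq, hd⟩ := exists_partial_solution n y₀ κ f hf p n
  have hd' := fun c j => hd c j j.2
  have huniq : ∀ δ : ℂ → Fin n → ℂ, (δ 0 = p ∧
      ∀ (c : ℂ) (j : Fin n), HasDerivAt (fun t => δ t j)
        (κ j * y₀ * δ c j + MvPolynomial.eval (δ c) (f j)) c) → δ = γ := fun δ hδ =>
    system_unique n y₀ κ f hf δ γ (hδ.1.trans h0.symm) hδ.2 hd'
  refine ⟨⟨γ, ⟨h0, hd'⟩, huniq⟩, fun δ hδ j => ?_⟩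
  rw [huniq δ hδ]
  exact hq j
end
end

section
/- Let {·,·} be a Poisson bracket on ℂ[x₁, …, x_n] and let y ∈ ℂ[x₁, …, x_n]. Assume that for each j = 1, …, n there exist κ_j ∈ ℂ and f_j ∈ ℂ[x₁, …, x_{j−1}] (f₁ a constant) such that {y, x_j} = κ_j x_j y + f_j. Then for every p ∈ ℂⁿ there exists a unique integral curve γ : ℂ → ℂⁿ of the Hamiltonian vector field H_y defined on all of ℂ with γ(0) = p; every component γ_j of γ is a quasi-polynomial, and y(γ(c)) = y(p) for all c ∈ ℂ. -/
noncomputable section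

open MvPolynomial

/-- A Poisson bracket on the polynomial algebra `ℂ[x₁, …, xₙ]`: a ℂ-bilinear,
antisymmetric map satisfying the Jacobi identity and the Leibniz rule in each
argument. -/
def IsPoissonBracket {n : ℕ}
    (B : MvPolynomial (Fin n) ℂ → MvPolynomial (Fin n) ℂ → MvPolynomial (Fin n) ℂ) :
    Prop :=
  (∀ f g h, B (f + g) h = B f h + B g h) ∧
  (∀ (r : ℂ) f g, B (r • f) g = r • B f g) ∧
  (∀ f g h, B f (g + h) = B f g + B f h) ∧
  (∀ (r : ℂ) f g, B f (r • g) = r • B f g) ∧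
  (∀ f g, B f g = - B g f) ∧
  (∀ f g h, B f (B g h) + B g (B h f) + B h (B f g) = 0) ∧
  (∀ f g h, B (f * g) h = f * B g h + g * B f h) ∧
  (∀ f g h, B f (g * h) = g * B f h + h * B f g)

lemma qp_fintype {ι : Type} [Fintype ι] (q : ι → Polynomial ℂ) (a : ι → ℂ) (g : ℂ → ℂ)
    (h : ∀ c, g c = ∑ k, (q k).eval c * Complex.exp (a k * c)) : IsQuasiPolynomial g := by
  refine ⟨Fintype.card ι, fun k => q ((Fintype.equivFin ι).symm k),
    fun k => a ((Fintype.equivFin ι).symm k), fun c => ?_⟩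
  rw [h c]
  exact ((Fintype.equivFin ι).symm.sum_comp
    (fun k => (q k).eval c * Complex.exp (a k * c))).symm

lemma qp_single (q : Polynomial ℂ) (a : ℂ) :
    IsQuasiPolynomial (fun c => q.eval c * Complex.exp (a * c)) :=
  qp_fintype (ι := Unit) (fun _ => q) (fun _ => a) _ (fun c => by simp)

lemma qp_const (r : ℂ) : IsQuasiPolynomial (fun _ => r) := by
  have := qp_single (Polynomial.C r) 0
  simpa using this

lemma qp_add {g h : ℂ → ℂ} (hg : IsQuasiPolynomial g) (hh : IsQuasiPolynomial h) :
    IsQuasiPolynomial (fun c => g c + h c) := by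
  obtain ⟨N, q, a, hg⟩ := hg
  obtain ⟨M, r, b, hh⟩ := hh
  refine qp_fintype (ι := Fin N ⊕ Fin M) (Sum.elim q r) (Sum.elim a b) _ (fun c => ?_)
  simp [hg c, hh c]

lemma qp_mul {g h : ℂ → ℂ} (hg : IsQuasiPolynomial g) (hh : IsQuasiPolynomial h) :
    IsQuasiPolynomial (fun c => g c * h c) := by
  obtain ⟨N, q, a, hg⟩ := hg
  obtain ⟨M, r, b, hh⟩ := hh
  refine qp_fintype (ι := Fin N × Fin M) (fun k => q k.1 * r k.2) (fun k => a k.1 + b k.2) _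
    (fun c => ?_)
  rw [hg c, hh c, Finset.sum_mul_sum, Fintype.sum_prod_type]
  refine Finset.sum_congr rfl fun i _ => Finset.sum_congr rfl fun j _ => ?_
  rw [add_mul, Complex.exp_add, Polynomial.eval_mul]
  ring

lemma qp_eval {n : ℕ} (γ : ℂ → Fin n → ℂ) (h : ∀ j, IsQuasiPolynomial fun c => γ c j)
    (q : MvPolynomial (Fin n) ℂ) : IsQuasiPolynomial fun c => MvPolynomial.eval (γ c) q := by
  induction q using MvPolynomial.induction_on with
  | C a => simpa using qp_const a
  | add p q hp hq => simpa using qp_add hp hq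
  | mul_X p i hp => simpa using qp_mul hp (h i)

lemma poly_ode (a : ℂ) (q : Polynomial ℂ) :
    ∃ r : Polynomial ℂ, Polynomial.derivative r + Polynomial.C a * r = q := by
  induction q using Polynomial.induction_on' with
  | add p q hp hq =>
    obtain ⟨r, hr⟩ := hp
    obtain ⟨s, hs⟩ := hq
    refine ⟨r + s, ?_⟩
    rw [← hr, ← hs, Polynomial.derivative_add]
    ring
  | monomial n b =>
    by_cases ha : a = 0
    · refine ⟨Polynomial.monomial (n + 1) (b / (n + 1)), ?_⟩
      have : (n : ℂ) + 1 ≠ 0 := by exact_mod_cast Nat.succ_ne_zero n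
      rw [Polynomial.derivative_monomial]
      simp [ha, this]
    · induction n generalizing b with
      | zero =>
        refine ⟨Polynomial.C (b / a), ?_⟩
        rw [Polynomial.derivative_C, ← Polynomial.C_mul, mul_div_cancel₀ _ ha, zero_add]
        rfl
      | succ n ih =>
        obtain ⟨r, hr⟩ := ih (b / a * (n + 1))
        refine ⟨Polynomial.monomial (n + 1) (b / a) - r, ?_⟩
        rw [Polynomial.derivative_sub, Polynomial.derivative_monomial, mul_sub,
          Polynomial.C_mul_monomial, mul_div_cancel₀ _ ha]
        have h2 : Polynomial.monomial (n + 1 - 1) (b / a * ((n + 1 : ℕ) : ℂ))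
            = Polynomial.derivative r + Polynomial.C a * r := by
          rw [hr]; simp
        rw [h2]
        ring

lemma qp_single_primitive (q : Polynomial ℂ) (a : ℂ) :
    ∃ F : ℂ → ℂ, IsQuasiPolynomial F ∧
      ∀ c, HasDerivAt F (q.eval c * Complex.exp (a * c)) c := by
  obtain ⟨r, hr⟩ := poly_ode a q
  refine ⟨_, qp_single r a, fun c => ?_⟩
  have h1 := r.hasDerivAt c
  have h2 : HasDerivAt (fun c : ℂ => Complex.exp (a * c)) (Complex.exp (a * c) * (a * 1)) c :=
    ((hasDerivAt_id c).const_mul a).cexp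
  refine HasDerivAt.congr_deriv (h1.mul h2) ?_
  rw [← hr]
  simp
  ring

lemma qp_primitive {g : ℂ → ℂ} (hg : IsQuasiPolynomial g) :
    ∃ F : ℂ → ℂ, IsQuasiPolynomial F ∧ ∀ c, HasDerivAt F (g c) c := by
  obtain ⟨N, q, a, hg⟩ := hg
  obtain rfl : g = _ := funext hg
  clear hg
  induction N with
  | zero => exact ⟨fun _ => 0, qp_const 0, fun c => by simpa using hasDerivAt_const c (0 : ℂ)⟩
  | succ N ih =>
    obtain ⟨F, hF, hF'⟩ := ih (fun k => q k.succ) (fun k => a k.succ)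
    obtain ⟨G, hG, hG'⟩ := qp_single_primitive (q 0) (a 0)
    refine ⟨_, qp_add hG hF, fun c => ?_⟩
    beta_reduce
    rw [Fin.sum_univ_succ]
    exact (hG' c).add (hF' c)

lemma hasDerivAt_exp_lin (a c : ℂ) :
    HasDerivAt (fun c : ℂ => Complex.exp (a * c)) (Complex.exp (a * c) * a) c := by
  simpa using ((hasDerivAt_id c).const_mul a).cexp

lemma qp_exp (a : ℂ) : IsQuasiPolynomial fun c => Complex.exp (a * c) := by
  simpa using qp_single 1 a

lemma qp_ode {g : ℂ → ℂ} (hg : IsQuasiPolynomial g) (a p : ℂ) :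
    ∃ F : ℂ → ℂ, IsQuasiPolynomial F ∧ F 0 = p ∧ ∀ c, HasDerivAt F (a * F c + g c) c := by
  obtain ⟨G, hG, hG'⟩ := qp_primitive (qp_mul hg (qp_exp (-a)))
  refine ⟨_, qp_mul (qp_exp a) (qp_add hG (qp_const (p - G 0))), by simp, fun c => ?_⟩
  refine HasDerivAt.congr_deriv ((hasDerivAt_exp_lin a c).mul ((hG' c).add_const (p - G 0))) ?_
  have : Complex.exp (a * c) * Complex.exp (-a * c) = 1 := by
    rw [← Complex.exp_add]; simp
  linear_combination (g c) * this

lemma lin_unique {w h H : ℂ → ℂ} (hH : ∀ c, HasDerivAt H (h c) c)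
    (hw : ∀ c, HasDerivAt w (h c * w c) c) (h0 : w 0 = 0) (c : ℂ) : w c = 0 := by
  have hd : ∀ c, HasDerivAt (fun t => w t * Complex.exp (-H t)) 0 c := fun c => by
    refine HasDerivAt.congr_deriv ((hw c).mul (hH c).neg.cexp) ?_
    simp
    ring
  have := is_const_of_deriv_eq_zero (fun c => (hd c).differentiableAt) (fun c => (hd c).deriv) c 0
  simpa [h0] using this

lemma chain_rule {n : ℕ} (D : Derivation ℂ (MvPolynomial (Fin n) ℂ) (MvPolynomial (Fin n) ℂ))
    (γ : ℂ → Fin n → ℂ) (c : ℂ)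
    (h : ∀ j, HasDerivAt (fun t => γ t j) (MvPolynomial.eval (γ c) (D (X j))) c)
    (q : MvPolynomial (Fin n) ℂ) :
    HasDerivAt (fun t => MvPolynomial.eval (γ t) q) (MvPolynomial.eval (γ c) (D q)) c := by
  induction q using MvPolynomial.induction_on with
  | C a => simpa using hasDerivAt_const c a
  | add p q hp hq =>
    simp only [map_add]
    exact hp.add hq
  | mul_X p i hp =>
    simp only [map_mul, eval_X, Derivation.leibniz, smul_eq_mul, map_add]
    refine HasDerivAt.congr_deriv (hp.mul (h i)) ?_
    ring

lemma eval_congr_supported_s2 {n : ℕ} (q : MvPolynomial (Fin n) ℂ) (s : Set (Fin n))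
    (hq : q ∈ MvPolynomial.supported ℂ s) (u v : Fin n → ℂ) (h : ∀ i ∈ s, u i = v i) :
    MvPolynomial.eval u q = MvPolynomial.eval v q := by
  rw [MvPolynomial.mem_supported] at hq
  exact MvPolynomial.eval₂Hom_congr' rfl (fun i hi _ => h i (hq hi)) rfl

lemma triangular_exists {n : ℕ} (a : Fin n → ℂ) (f : Fin n → MvPolynomial (Fin n) ℂ)
    (hf : ∀ j : Fin n, f j ∈ MvPolynomial.supported ℂ {i : Fin n | (i : ℕ) < (j : ℕ)})
    (p : Fin n → ℂ) (m : ℕ) :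
    ∃ γ : ℂ → Fin n → ℂ, γ 0 = p ∧ (∀ j, IsQuasiPolynomial fun c => γ c j) ∧
      ∀ j : Fin n, (j : ℕ) < m → ∀ c, HasDerivAt (fun t => γ t j)
        (a j * γ c j + MvPolynomial.eval (γ c) (f j)) c := by
  induction m with
  | zero => exact ⟨fun _ => p, rfl, fun j => qp_const _, fun j hj => absurd hj (Nat.not_lt_zero _)⟩
  | succ m ih =>
    obtain ⟨γ, h0, hq, hd⟩ := ih
    by_cases hm : m < n
    · obtain ⟨F, hF, hF0, hF'⟩ := qp_ode (qp_eval γ hq (f ⟨m, hm⟩)) (a ⟨m, hm⟩) (p ⟨m, hm⟩)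
      have hne : ∀ j : Fin n, j ≠ ⟨m, hm⟩ → ∀ c,
          Function.update (γ c) ⟨m, hm⟩ (F c) j = γ c j := fun j hj c => by
        rw [Function.update_of_ne hj]
      have heq : ∀ c, Function.update (γ c) ⟨m, hm⟩ (F c) ⟨m, hm⟩ = F c := fun c => by
        rw [Function.update_self]
      have hev : ∀ j : Fin n, (j : ℕ) < m + 1 → ∀ c,
          MvPolynomial.eval (Function.update (γ c) ⟨m, hm⟩ (F c)) (f j)
            = MvPolynomial.eval (γ c) (f j) := fun j hj c => by
        refine eval_congr_supported_s2 _ _ (hf j) _ _ fun i hi => hne i ?_ c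
        rintro rfl
        simp only [Set.mem_ofPred_eq] at hi
        omega
      refine ⟨fun c => Function.update (γ c) ⟨m, hm⟩ (F c), ?_, fun j => ?_, fun j hj c => ?_⟩
      · simp only [hF0, h0, Function.update_eq_self]
      · by_cases hj : j = ⟨m, hm⟩
        · subst hj
          simpa only [heq] using hF
        · simpa only [hne j hj] using hq j
      · rw [hev j hj c]
        by_cases hj' : j = ⟨m, hm⟩
        · subst hj'
          simpa only [heq] using hF' c
        · simp only [hne j hj']
          refine hd j ?_ c
          have : (j : ℕ) ≠ m := fun h => hj' (Fin.ext h)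
          omega
    · exact ⟨γ, h0, hq, fun j _ => hd j (by omega)⟩

lemma triangular_unique {n : ℕ} (a : Fin n → ℂ) (f : Fin n → MvPolynomial (Fin n) ℂ)
    (hf : ∀ j : Fin n, f j ∈ MvPolynomial.supported ℂ {i : Fin n | (i : ℕ) < (j : ℕ)})
    (γ δ : ℂ → Fin n → ℂ) (h0 : γ 0 = δ 0)
    (hγ : ∀ c j, HasDerivAt (fun t => γ t j) (a j * γ c j + MvPolynomial.eval (γ c) (f j)) c)
    (hδ : ∀ c j, HasDerivAt (fun t => δ t j) (a j * δ c j + MvPolynomial.eval (δ c) (f j)) c) :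
    γ = δ := by
  have key : ∀ m : ℕ, ∀ j : Fin n, (j : ℕ) = m → ∀ c, γ c j = δ c j := by
    intro m
    induction m using Nat.strong_induction_on with
    | _ m ih =>
      intro j hj c
      have := lin_unique (w := fun t => γ t j - δ t j) (h := fun _ => a j) (H := fun t => a j * t)
        (fun c => by simpa using (hasDerivAt_id c).const_mul (a j))
        (fun c => by
          refine HasDerivAt.congr_deriv ((hγ c j).sub (hδ c j)) ?_
          rw [eval_congr_supported_s2 _ _ (hf j) (γ c) (δ c)
            (fun i hi => ih i (by simp only [Set.mem_ofPred_eq] at hi; omega) i rfl c)]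
          ring) (by simp [h0]) c
      exact sub_eq_zero.mp this
  funext c j
  exact key j j rfl c

/-- The Hamiltonian derivation. -/
def hamDer {n : ℕ}
    (B : MvPolynomial (Fin n) ℂ → MvPolynomial (Fin n) ℂ → MvPolynomial (Fin n) ℂ)
    (hB : IsPoissonBracket B) (y : MvPolynomial (Fin n) ℂ) :
    Derivation ℂ (MvPolynomial (Fin n) ℂ) (MvPolynomial (Fin n) ℂ) :=
  Derivation.mk'
    { toFun := B y
      map_add' := hB.2.2.1 y
      map_smul' := fun r g => hB.2.2.2.1 r y g }
    (fun g h => hB.2.2.2.2.2.2.2 y g h)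

lemma hamDer_apply {n : ℕ}
    (B : MvPolynomial (Fin n) ℂ → MvPolynomial (Fin n) ℂ → MvPolynomial (Fin n) ℂ)
    (hB : IsPoissonBracket B) (y q : MvPolynomial (Fin n) ℂ) : hamDer B hB y q = B y q := rfl

lemma bracket_self {n : ℕ}
    (B : MvPolynomial (Fin n) ℂ → MvPolynomial (Fin n) ℂ → MvPolynomial (Fin n) ℂ)
    (hB : IsPoissonBracket B) (y : MvPolynomial (Fin n) ℂ) : B y y = 0 :=
  self_eq_neg.mp (hB.2.2.2.2.1 y y)

/-- If `{y, xⱼ} = κⱼ xⱼ y + fⱼ` with `fⱼ ∈ ℂ[x₁, …, x_{j-1}]` for all `j`, then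
through every point of `ℂⁿ` there is a unique integral curve of the Hamiltonian
vector field of `y` defined on all of `ℂ`; its components are quasi-polynomials
and `y` is constant along it. -/
theorem stmt_2 (n : ℕ)
    (B : MvPolynomial (Fin n) ℂ → MvPolynomial (Fin n) ℂ → MvPolynomial (Fin n) ℂ)
    (hB : IsPoissonBracket B)
    (y : MvPolynomial (Fin n) ℂ) (κ : Fin n → ℂ)
    (f : Fin n → MvPolynomial (Fin n) ℂ)
    (hf : ∀ j : Fin n, f j ∈ MvPolynomial.supported ℂ {i : Fin n | (i : ℕ) < (j : ℕ)})
    (hbr : ∀ j : Fin n, B y (X j) = C (κ j) * X j * y + f j)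
    (p : Fin n → ℂ) :
    (∃! γ : ℂ → Fin n → ℂ, γ 0 = p ∧
      ∀ (c : ℂ) (j : Fin n), HasDerivAt (fun t => γ t j)
        (MvPolynomial.eval (γ c) (B y (X j))) c) ∧
    (∀ γ : ℂ → Fin n → ℂ,
      (γ 0 = p ∧
        ∀ (c : ℂ) (j : Fin n), HasDerivAt (fun t => γ t j)
          (MvPolynomial.eval (γ c) (B y (X j))) c) →
      (∀ j : Fin n, IsQuasiPolynomial fun c => γ c j) ∧
      (∀ c : ℂ, MvPolynomial.eval (γ c) y = MvPolynomial.eval p y)) := by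
  set l := MvPolynomial.eval p y with hl
  -- `y` is constant along integral curves
  have hconst : ∀ γ : ℂ → Fin n → ℂ, (γ 0 = p ∧
      ∀ (c : ℂ) (j : Fin n), HasDerivAt (fun t => γ t j)
        (MvPolynomial.eval (γ c) (B y (X j))) c) →
      ∀ c : ℂ, MvPolynomial.eval (γ c) y = l := by
    rintro γ ⟨h0, hγ⟩ c
    have hd : ∀ c, HasDerivAt (fun t => MvPolynomial.eval (γ t) y) 0 c := fun c => by
      have := chain_rule (hamDer B hB y) γ c (fun j => hγ c j) y
      rwa [hamDer_apply, bracket_self B hB, map_zero] at this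
    have := is_const_of_deriv_eq_zero (fun c => (hd c).differentiableAt)
      (fun c => (hd c).deriv) c 0
    simpa only [h0] using this
  have hlin : ∀ γ : ℂ → Fin n → ℂ, (γ 0 = p ∧
      ∀ (c : ℂ) (j : Fin n), HasDerivAt (fun t => γ t j)
        (MvPolynomial.eval (γ c) (B y (X j))) c) →
      ∀ (c : ℂ) (j : Fin n), HasDerivAt (fun t => γ t j)
        ((κ j * l) * γ c j + MvPolynomial.eval (γ c) (f j)) c := by
    intro γ h c j
    refine HasDerivAt.congr_deriv (h.2 c j) ?_
    rw [hbr j]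
    simp only [map_add, map_mul, eval_C, eval_X, hconst γ h c]
    ring
  obtain ⟨γ, h0, hq, hd⟩ := triangular_exists (fun j => κ j * l) f hf p n
  have hd' : ∀ (c : ℂ) (j : Fin n), HasDerivAt (fun t => γ t j)
        ((κ j * l) * γ c j + MvPolynomial.eval (γ c) (f j)) c := fun c j => hd j j.2 c
  -- the auxiliary derivations
  let D := MvPolynomial.mkDerivation ℂ (fun j : Fin n => C (κ j * l) * X j + f j)
  let E := MvPolynomial.mkDerivation ℂ
    (fun j : Fin n => (C (κ j) * X j : MvPolynomial (Fin n) ℂ))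
  have hDE : hamDer B hB y = D + (y - C l) • E := by
    apply MvPolynomial.derivation_ext
    intro j
    simp only [hamDer_apply, hbr, D, E, Derivation.add_apply, Derivation.smul_apply,
      mkDerivation_X, smul_eq_mul, map_mul]
    ring
  have hDy : D y = - (y - C l) * E y := by
    have := congrArg (fun d => d y) hDE
    simp only [hamDer_apply, bracket_self B hB, Derivation.add_apply, Derivation.smul_apply,
      smul_eq_mul] at this
    linear_combination -this
  have hy : ∀ c, MvPolynomial.eval (γ c) y = l := by
    intro c
    obtain ⟨H, -, hH⟩ := qp_primitive (qp_eval γ hq (-(E y)))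
    have := lin_unique (w := fun t => MvPolynomial.eval (γ t) y - l) hH (fun c => by
      have h1 := chain_rule D γ c (fun j => by
        simpa only [D, mkDerivation_X, map_add, map_mul, eval_C, eval_X] using hd' c j) y
      refine HasDerivAt.congr_deriv (h1.sub_const l) ?_
      rw [hDy]
      simp only [map_mul, map_neg, map_sub, eval_C]
      ring) (by simp only [h0, hl, sub_self]) c
    exact sub_eq_zero.mp this
  have hγ : γ 0 = p ∧ ∀ (c : ℂ) (j : Fin n), HasDerivAt (fun t => γ t j)
        (MvPolynomial.eval (γ c) (B y (X j))) c := by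
    refine ⟨h0, fun c j => ?_⟩
    refine HasDerivAt.congr_deriv (hd' c j) ?_
    rw [hbr j]
    simp only [map_add, map_mul, eval_C, eval_X, hy c]
    ring
  have huniq : ∀ δ : ℂ → Fin n → ℂ, (δ 0 = p ∧
      ∀ (c : ℂ) (j : Fin n), HasDerivAt (fun t => δ t j)
        (MvPolynomial.eval (δ c) (B y (X j))) c) → δ = γ := fun δ hδ =>
    triangular_unique (fun j => κ j * l) f hf δ γ (hδ.1.trans h0.symm) (hlin δ hδ) hd'
  refine ⟨⟨γ, hγ, huniq⟩, fun δ hδ => ⟨fun j => ?_, hconst δ hδ⟩⟩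
  rw [huniq δ hδ]
  exact hq j
end
end

section
/- Let P₁, …, P_n ∈ ℂ[x₁, …, x_n] and let a₁, …, a_m ∈ ℂ[x₁, …, x_n] be such that for each k = 1, …, m the derivative of a_k along the polynomial vector field (P₁, …, P_n), namely ∑_{j=1}^n P_j · ∂a_k/∂x_j, lies in the ideal of ℂ[x₁, …, x_n] generated by a₁, …, a_m. If γ : ℂ → ℂⁿ is a differentiable map with γ_j′(c) = P_j(γ(c)) for all c ∈ ℂ and all j, and a_k(γ(0)) = 0 for all k = 1, …, m, then a_k(γ(c)) = 0 for all c ∈ ℂ and all k = 1, …, m. (In particular, the common zero set of a₁, …, a_m is invariant under the flow of the vector field.) -/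
noncomputable section

open MvPolynomial

/-- Chain rule for a polynomial evaluated along an integral curve. -/
theorem hasDerivAt_eval_curve {n : ℕ} (P : Fin n → MvPolynomial (Fin n) ℂ)
    (γ : ℂ → Fin n → ℂ) (c : ℂ)
    (hode : ∀ j : Fin n, HasDerivAt (fun t => γ t j) (MvPolynomial.eval (γ c) (P j)) c)
    (p : MvPolynomial (Fin n) ℂ) :
    HasDerivAt (fun t => MvPolynomial.eval (γ t) p)
      (MvPolynomial.eval (γ c) (∑ j : Fin n, P j * MvPolynomial.pderiv j p)) c := by
  induction p using MvPolynomial.induction_on with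
  | C x => simpa using hasDerivAt_const c x
  | add p q hp hq =>
    simp only [map_add, mul_add, Finset.sum_add_distrib]
    exact hp.add hq
  | mul_X p i hp =>
    have h := hp.mul (hode i)
    simp only [map_mul, eval_X]
    refine h.congr_deriv ?_
    classical
    simp only [Derivation.leibniz, pderiv_X, smul_eq_mul, map_sum, map_mul, map_add, eval_X,
      mul_add, Finset.sum_add_distrib, Finset.sum_mul, Pi.single_apply]
    rw [add_comm]
    congr 1
    · simp [apply_ite, mul_comm]
    · exact Finset.sum_congr rfl fun j _ => by ring

/-- If the derivative of each `aₖ` along the polynomial vector field `(P₁, …, Pₙ)`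
lies in the ideal generated by `a₁, …, aₘ`, then the common zero set of the `aₖ`
is invariant under the flow of the vector field. -/
theorem stmt_3 (n m : ℕ) (P : Fin n → MvPolynomial (Fin n) ℂ)
    (a : Fin m → MvPolynomial (Fin n) ℂ)
    (hinv : ∀ k : Fin m,
      (∑ j : Fin n, P j * MvPolynomial.pderiv j (a k)) ∈ Ideal.span (Set.range a))
    (γ : ℂ → Fin n → ℂ)
    (hode : ∀ (c : ℂ) (j : Fin n),
      HasDerivAt (fun t => γ t j) (MvPolynomial.eval (γ c) (P j)) c)
    (h0 : ∀ k : Fin m, MvPolynomial.eval (γ 0) (a k) = 0) :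
    ∀ (c : ℂ) (k : Fin m), MvPolynomial.eval (γ c) (a k) = 0 := by
  intro c
  have hex : ∀ k, ∃ b : Fin m → MvPolynomial (Fin n) ℂ,
      ∑ l, b l * a l = ∑ j : Fin n, P j * MvPolynomial.pderiv j (a k) := by
    intro k
    exact (Ideal.mem_span_range_iff_exists_fun).1 (hinv k)
  choose b hb using hex
  have hcurve : ∀ (p : MvPolynomial (Fin n) ℂ) (t : ℝ),
      HasDerivAt (fun s : ℝ => MvPolynomial.eval (γ ((s : ℂ) * c)) p)
        (MvPolynomial.eval (γ ((t : ℂ) * c)) (∑ j : Fin n, P j * MvPolynomial.pderiv j p) * c) t := by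
    intro p t
    have h1 := hasDerivAt_eval_curve P γ ((t : ℂ) * c) (hode _) p
    have h2 : HasDerivAt (fun s : ℂ => s * c) c (t : ℂ) := by
      simpa using (hasDerivAt_id (t : ℂ)).mul_const c
    exact (HasDerivAt.comp (t : ℂ) h1 h2).comp_ofReal
  have hcont : ∀ p : MvPolynomial (Fin n) ℂ,
      Continuous (fun s : ℝ => MvPolynomial.eval (γ ((s : ℂ) * c)) p) := fun p =>
    continuous_iff_continuousAt.2 fun t => (hcurve p t).continuousAt
  let B : ℝ → ℝ := fun t => ∑ k, ∑ l, ‖MvPolynomial.eval (γ ((t : ℂ) * c)) (b k l)‖ * ‖c‖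
  have hB : Continuous B := continuous_finsetSum _ fun k _ => continuous_finsetSum _ fun l _ =>
    (hcont (b k l)).norm.mul continuous_const
  obtain ⟨K, hK⟩ := (isCompact_Icc (a := (0 : ℝ)) (b := 1)).bddAbove_image hB.continuousOn
  let f : ℝ → Fin m → ℂ := fun t k => MvPolynomial.eval (γ ((t : ℂ) * c)) (a k)
  let f' : ℝ → Fin m → ℂ := fun t k => (∑ l, MvPolynomial.eval (γ ((t : ℂ) * c)) (b k l) * f t l) * c
  have hf : ∀ t, HasDerivAt f (f' t) t := by
    intro t
    rw [hasDerivAt_pi]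
    intro k
    refine (hcurve (a k) t).congr_deriv ?_
    rw [← hb k]
    simp [f', f]
  have key := eq_zero_of_abs_deriv_le_mul_abs_self_of_eq_zero_right (f := f) (f' := f') (K := K)
    (a := 0) (b := 1) (fun t _ => (hf t).continuousAt.continuousWithinAt)
    (fun t _ => (hf t).hasDerivWithinAt) (by ext k; simpa [f] using h0 k) ?_
  · intro k
    have := congrFun (key 1 (by simp)) k
    simpa [f] using this
  · intro t ht
    have hBt : B t ≤ K := hK ⟨t, ⟨ht.1, ht.2.le⟩, rfl⟩
    refine le_trans ?_ (mul_le_mul_of_nonneg_right hBt (norm_nonneg _))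
    have hB0 : 0 ≤ B t := by positivity
    rw [pi_norm_le_iff_of_nonneg (by positivity)]
    intro k
    calc ‖f' t k‖ = ‖∑ l, MvPolynomial.eval (γ ((t : ℂ) * c)) (b k l) * f t l‖ * ‖c‖ := norm_mul _ _
      _ ≤ (∑ l, ‖MvPolynomial.eval (γ ((t : ℂ) * c)) (b k l)‖ * ‖f t‖) * ‖c‖ := by
        gcongr
        refine norm_sum_le_of_le _ fun l _ => ?_
        rw [norm_mul]
        gcongr
        exact norm_le_pi_norm (f t) l
      _ = (∑ l, ‖MvPolynomial.eval (γ ((t : ℂ) * c)) (b k l)‖ * ‖c‖) * ‖f t‖ := by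
        rw [← Finset.sum_mul, ← Finset.sum_mul]; ring
      _ ≤ B t * ‖f t‖ := by
        gcongr
        exact Finset.single_le_sum
          (f := fun k => ∑ l, ‖MvPolynomial.eval (γ ((t : ℂ) * c)) (b k l)‖ * ‖c‖)
          (fun _ _ => by positivity) (Finset.mem_univ k)
end
end

section
/- Let {·,·} be a Poisson bracket on ℂ[x₁, …, x_n], let y, g ∈ ℂ[x₁, …, x_n] and κ ∈ ℂ with {y, g} = κ y g. Let γ : ℂ → ℂⁿ be an integral curve of the Hamiltonian vector field H_y defined on all of ℂ, and set p = γ(0). Then g(γ(c)) = g(p) · e^{κ y(p) c} for all c ∈ ℂ. In particular, if g(p) ≠ 0 then g(γ(c)) ≠ 0 for all c ∈ ℂ, so the principal open set {g ≠ 0} is invariant under the Hamiltonian flow of y. -/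
noncomputable section

open MvPolynomial

/-- If `{y, g} = κ y g` and `γ` is an integral curve of the Hamiltonian vector
field of `y` defined on all of `ℂ` with `γ(0) = p`, then
`g(γ(c)) = g(p) e^{κ y(p) c}`; in particular if `g(p) ≠ 0` then `g` never
vanishes along the curve. -/
theorem stmt_4 (n : ℕ)
    (B : MvPolynomial (Fin n) ℂ → MvPolynomial (Fin n) ℂ → MvPolynomial (Fin n) ℂ)
    (hB : IsPoissonBracket B)
    (y g : MvPolynomial (Fin n) ℂ) (κ : ℂ)
    (hyg : B y g = C κ * (y * g))
    (γ : ℂ → Fin n → ℂ)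
    (hode : ∀ (c : ℂ) (j : Fin n),
      HasDerivAt (fun t => γ t j) (MvPolynomial.eval (γ c) (B y (X j))) c) :
    (∀ c : ℂ, MvPolynomial.eval (γ c) g
      = MvPolynomial.eval (γ 0) g * Complex.exp (κ * MvPolynomial.eval (γ 0) y * c)) ∧
    (MvPolynomial.eval (γ 0) g ≠ 0 → ∀ c : ℂ, MvPolynomial.eval (γ c) g ≠ 0) := by
  obtain ⟨-, -, hadd, hsmul, hanti, -, -, hmul⟩ := hB
  have hone : B y 1 = 0 := by
    have h := hmul y 1 1
    simp only [one_mul] at h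
    simpa using h
  have hC : ∀ r : ℂ, B y (C r) = 0 := by
    intro r
    have h := hsmul r y 1
    rw [hone, smul_zero, MvPolynomial.smul_eq_C_mul, mul_one] at h
    exact h
  have hyy : B y y = 0 := self_eq_neg.mp (hanti y y)
  -- chain rule along the curve
  have key : ∀ (f : MvPolynomial (Fin n) ℂ) (c : ℂ),
      HasDerivAt (fun t => MvPolynomial.eval (γ t) f) (MvPolynomial.eval (γ c) (B y f)) c := by
    intro f c
    induction f using MvPolynomial.induction_on with
    | C a => simpa [hC] using hasDerivAt_const c a
    | add p q hp hq =>
      rw [hadd]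
      simp only [map_add]
      exact hp.add hq
    | mul_X p i hp =>
      rw [hmul]
      simp only [map_add, map_mul, eval_X]
      refine (hp.mul (hode c i)).congr_deriv ?_
      ring
  have hyc : ∀ c, MvPolynomial.eval (γ c) y = MvPolynomial.eval (γ 0) y := by
    intro c
    have hd : ∀ t, HasDerivAt (fun t => MvPolynomial.eval (γ t) y) 0 t := by
      intro t
      simpa [hyy] using key y t
    exact is_const_of_deriv_eq_zero (fun t => (hd t).differentiableAt)
      (fun t => (hd t).deriv) c 0
  have main : ∀ c : ℂ, MvPolynomial.eval (γ c) g
      = MvPolynomial.eval (γ 0) g * Complex.exp (κ * MvPolynomial.eval (γ 0) y * c) := by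
    intro c
    set a := κ * MvPolynomial.eval (γ 0) y with ha
    have hd : ∀ t, HasDerivAt
        (fun t => MvPolynomial.eval (γ t) g * Complex.exp (-(a * t))) 0 t := by
      intro t
      have h1 := key g t
      have h2 : HasDerivAt (fun t : ℂ => Complex.exp (-(a * t)))
          (Complex.exp (-(a * t)) * (-(a * 1))) t :=
        (((hasDerivAt_id t).const_mul a).neg).cexp
      refine (h1.mul h2).congr_deriv ?_
      rw [hyg]
      simp only [map_mul, eval_C, hyc t, ha]
      ring
    have h := is_const_of_deriv_eq_zero (fun t => (hd t).differentiableAt)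
      (fun t => (hd t).deriv) c 0
    simp only [mul_zero, neg_zero, Complex.exp_zero, mul_one] at h
    rw [← h, mul_assoc, ← Complex.exp_add]
    simp
  refine ⟨main, fun h0 c => ?_⟩
  rw [main c]
  exact mul_ne_zero h0 (Complex.exp_ne_zero _)
end
end

section
/- Let R = ℂ[x₁, …, x_n] and let B : R × R → R be a ℂ-bilinear map that is a derivation in its first argument, i.e. B(fg, h) = f·B(g, h) + g·B(f, h) for all f, g, h ∈ R. Let y ∈ R be nonzero and suppose y divides B(y, f) for every f ∈ R. If y₁ is a prime element of R with y = y₁ᵏ y₂ for some integer k ≥ 1 and some y₂ ∈ R not divisible by y₁, then y₁ divides B(y₁, f) for every f ∈ R. (In other words, every prime factor of a Poisson element is again a Poisson element.) -/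
noncomputable section

/-- Every prime factor of a "Poisson element" is again a Poisson element: if
`B` is a ℂ-bilinear bracket on `ℂ[x₁, …, xₙ]` which is a derivation in its first
argument, `y ≠ 0` satisfies `y ∣ B(y, f)` for all `f`, and `y = y₁ᵏ y₂` with
`y₁` prime, `k ≥ 1` and `y₁ ∤ y₂`, then `y₁ ∣ B(y₁, f)` for all `f`. -/
theorem stmt_6 (n : ℕ)
    (B : MvPolynomial (Fin n) ℂ → MvPolynomial (Fin n) ℂ → MvPolynomial (Fin n) ℂ)
    (hadd1 : ∀ f g h, B (f + g) h = B f h + B g h)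
    (hsmul1 : ∀ (r : ℂ) f g, B (r • f) g = r • B f g)
    (hadd2 : ∀ f g h, B f (g + h) = B f g + B f h)
    (hsmul2 : ∀ (r : ℂ) f g, B f (r • g) = r • B f g)
    (hleib : ∀ f g h, B (f * g) h = f * B g h + g * B f h)
    (y : MvPolynomial (Fin n) ℂ) (hy : y ≠ 0)
    (hdvd : ∀ f, y ∣ B y f)
    (y₁ y₂ : MvPolynomial (Fin n) ℂ) (hprime : Prime y₁)
    (k : ℕ) (hk : 1 ≤ k) (hfac : y = y₁ ^ k * y₂) (hnd : ¬ y₁ ∣ y₂) :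
    ∀ f, y₁ ∣ B y₁ f := by
  intro f
  obtain ⟨m, rfl⟩ : ∃ m, k = m + 1 := ⟨k - 1, by omega⟩
  have hpow : ∀ m : ℕ, B (y₁ ^ (m + 1)) f = ((m : MvPolynomial (Fin n) ℂ) + 1) * y₁ ^ m * B y₁ f := by
    intro m
    induction m with
    | zero => simp
    | succ m ih =>
      rw [pow_succ y₁ (m + 1), hleib, ih]
      push_cast
      ring
  obtain ⟨c, hc⟩ := hdvd f
  rw [hfac, hleib, hpow] at hc
  have h0 : y₁ ^ m ≠ 0 := pow_ne_zero _ hprime.ne_zero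
  have key : (((m : MvPolynomial (Fin n) ℂ) + 1) * y₂) * B y₁ f = y₁ * (y₂ * c - B y₂ f) := by
    apply mul_left_cancel₀ h0
    linear_combination hc
  have hd : y₁ ∣ (((m : MvPolynomial (Fin n) ℂ) + 1) * y₂) * B y₁ f := ⟨_, key⟩
  rcases hprime.dvd_or_dvd hd with h | h
  · rcases hprime.dvd_or_dvd h with h | h
    · exfalso
      apply hprime.not_unit
      refine isUnit_of_dvd_unit h ?_
      have hu : IsUnit ((m : ℂ) + 1) := (Nat.cast_add_one_ne_zero m).isUnit
      simpa using hu.map (MvPolynomial.C (σ := Fin n))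
    · exact absurd h hnd
  · exact h
end
end

section
/- Let n ≥ 1 and let {·,·} be the bracket on ℂ[x₁, …, x_{2n}] determined as an antisymmetric biderivation by {x_i, x_{i+1}} = x_i x_{i+1} − 1 for 1 ≤ i ≤ 2n−1 and {x_i, x_j} = (−1)^{j−i+1} x_i x_j for 1 ≤ i < j ≤ 2n with j − i ≥ 2. For k = 1, …, n let y_k = E_{2k}(x_{n−k+1}, x_{n−k+2}, …, x_{n+k}), where E denotes the Euler continuants. Then {y_k, y_l} = 0 for all 1 ≤ k, l ≤ n. -/
noncomputable section

open MvPolynomial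

/-- The continuant polynomials of a sequence `v 0, v 1, …`:
`cont v 0 = 1`, `cont v 1 = v 0`,
`cont v (j+2) = v (j+1) * cont v (j+1) - cont v j`.  These are the Euler
continuants `E_j` in the variables `v 0, …, v (j-1)`. -/
def cont {R : Type*} [CommRing R] (v : ℕ → R) : ℕ → R
  | 0 => 1
  | 1 => v 0
  | (j + 2) => v (j + 1) * cont v (j + 1) - cont v j

/-- The variable `x_{i+1}` of `ℂ[x₁, …, x_N]` (1-based paper indexing
`x₁, …, x_N` corresponds to `xvar N 0, …, xvar N (N-1)`). -/
def xvar (N : ℕ) (i : ℕ) : MvPolynomial (Fin N) ℂ :=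
  if h : i < N then X (⟨i, h⟩ : Fin N) else 0

/-- The bracket on `ℂ[x₁, …, x_N]` associated to coefficients `c i j`
(`i < j`), which is the unique antisymmetric biderivation with
`{xᵢ, xⱼ} = c i j`. -/
def pbracket {N : ℕ} (c : Fin N → Fin N → MvPolynomial (Fin N) ℂ)
    (f g : MvPolynomial (Fin N) ℂ) : MvPolynomial (Fin N) ℂ :=
  ∑ i : Fin N, ∑ j : Fin N,
    if (i : ℕ) < (j : ℕ) then
      c i j * (pderiv i f * pderiv j g - pderiv j f * pderiv i g)
    else 0

/-- Coefficients of the standard Poisson bracket on the generalized Bruhat cell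
for `SL(2, ℂ)`: `{xᵢ, x_{i+1}} = xᵢx_{i+1} - 1` and
`{xᵢ, xⱼ} = (-1)^{j-i+1} xᵢxⱼ` for `j - i ≥ 2`. -/
def cSL (N : ℕ) (i j : Fin N) : MvPolynomial (Fin N) ℂ :=
  if (j : ℕ) = (i : ℕ) + 1 then X i * X j - 1
  else (-1 : MvPolynomial (Fin N) ℂ) ^ ((j : ℕ) - (i : ℕ) + 1) * (X i * X j)

/-- shifted prefix continuants: `pp v (j+1) = cont v j`, `pp v 0 = 0` -/
def pp {R : Type*} [CommRing R] (v : ℕ → R) : ℕ → R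
  | 0 => 0
  | 1 => 1
  | (j + 2) => v j * pp v (j + 1) - pp v j

theorem cont_eq_pp {R : Type*} [CommRing R] (v : ℕ → R) (j : ℕ) :
    cont v j = pp v (j + 1) ∧ cont v (j + 1) = pp v (j + 2) := by
  induction j with
  | zero => simp [cont, pp]
  | succ j ih =>
    refine ⟨ih.2, ?_⟩
    rw [cont, pp, ih.1, ih.2]

/-- suffix continuants -/
def qq {R : Type*} [CommRing R] (v : ℕ → R) (L j : ℕ) : R :=
  pp (fun i => v (L - 1 - i)) (L + 1 - j)

theorem qq_top {R : Type*} [CommRing R] (v : ℕ → R) (L : ℕ) : qq v L (L + 1) = 0 := by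
  simp [qq, pp]

theorem qq_L {R : Type*} [CommRing R] (v : ℕ → R) (L : ℕ) : qq v L L = 1 := by
  simp [qq, pp]

theorem qq_rec {R : Type*} [CommRing R] (v : ℕ → R) (L j : ℕ) (h : j < L) :
    qq v L j = v j * qq v L (j + 1) - qq v L (j + 2) := by
  obtain ⟨i, rfl⟩ : ∃ i, L = j + i + 1 := ⟨L - j - 1, by omega⟩
  unfold qq
  have h1 : j + i + 1 + 1 - j = i + 2 := by omega
  have h2 : j + i + 1 + 1 - (j + 1) = i + 1 := by omega
  have h3 : j + i + 1 + 1 - (j + 2) = i := by omega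
  have h4 : j + i + 1 - 1 - i = j := by omega
  rw [h1, h2, h3, pp, h4]

theorem wron {R : Type*} [CommRing R] (v : ℕ → R) (L k : ℕ) (h : k ≤ L) :
    pp v (k + 1) * qq v L k - pp v k * qq v L (k + 1) = pp v (L + 1) := by
  induction h using Nat.decreasingInduction with
  | self => rw [qq_L, qq_top]; ring
  | of_succ k hk ih =>
    rw [← ih, qq_rec v L k hk, pp]; ring

theorem dcont_sum {R : Type*} [CommRing R] [Algebra ℂ R] (D : Derivation ℂ R R) (v : ℕ → R)
    (L : ℕ) :
    D (pp v (L + 1)) = ∑ j ∈ Finset.range L, pp v (j + 1) * qq v L (j + 1) * D (v j) := by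
  have key : ∀ k ≤ L, D (pp v (k + 1)) * qq v L k - D (pp v k) * qq v L (k + 1)
      = ∑ j ∈ Finset.range k, pp v (j + 1) * qq v L (j + 1) * D (v j) := by
    intro k
    induction k with
    | zero => intro _; simp [pp]
    | succ k ih =>
      intro hk
      rw [Finset.sum_range_succ, ← ih (by omega), qq_rec v L k (by omega), pp]
      simp only [map_sub, Derivation.leibniz, smul_eq_mul]
      ring
  have := key L le_rfl
  rw [qq_L, qq_top] at this
  rw [← this]; ring

theorem S_sum {R : Type*} [CommRing R] (v : ℕ → R) (L k : ℕ) (h : k ≤ L) :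
    ∑ j ∈ Finset.range k, pp v (j + 1) * qq v L (j + 1) * ((-1) ^ j * v j)
      = -(-1) ^ k * (pp v k * qq v L (k + 1)) + if Even k then 0 else pp v (L + 1) := by
  induction k with
  | zero => simp [pp]
  | succ k ih =>
    have hw := wron v L k (by omega)
    rw [Finset.sum_range_succ, ih (by omega)]
    rw [qq_rec v L k (by omega)] at hw
    by_cases hk : Even k
    · have : ¬ Even (k + 1) := by simpa [Nat.even_add_one] using hk
      rw [if_pos hk, if_neg this, pow_succ, hk.neg_one_pow]
      linear_combination hw
    · have : Even (k + 1) := by simpa [Nat.even_add_one] using hk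
      rw [if_neg hk, if_pos this, pow_succ, (Nat.not_even_iff_odd.mp hk).neg_one_pow]
      linear_combination -hw

theorem S_zero {R : Type*} [CommRing R] (v : ℕ → R) (L : ℕ) (h : Even L) :
    ∑ j ∈ Finset.range L, pp v (j + 1) * qq v L (j + 1) * ((-1) ^ j * v j) = 0 := by
  rw [S_sum v L L le_rfl, if_pos h, qq_top]; ring

/-- bracket of variables with positions m, j -/
def om {R : Type*} [CommRing R] (v : ℕ → R) (m j : ℕ) : R :=
  (-1) ^ m * v m * ((-1) ^ j * v j) *
    ((if j < m then 1 else 0) + (if j < m + 1 then 1 else 0) - 1)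
    + (if j + 1 = m then 1 else 0) - (if j = m + 1 then 1 else 0)

theorem om_sum {R : Type*} [CommRing R] (v : ℕ → R) (L m : ℕ) (hL : Even L) (hm : m < L) :
    ∑ j ∈ Finset.range L, pp v (j + 1) * qq v L (j + 1) * om v m j
      = (-1) ^ m * v m * pp v (L + 1) := by
  have hres : ∀ (f : ℕ → R) (k : ℕ), k ≤ L →
      ∑ j ∈ Finset.range L, f j * (if j < k then 1 else 0) = ∑ j ∈ Finset.range k, f j := by
    intro f k hk
    simp only [mul_ite, mul_one, mul_zero]
    rw [← Finset.sum_filter]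
    congr 1
    ext j; simp; omega
  have h1 : ∑ j ∈ Finset.range L, pp v (j + 1) * qq v L (j + 1) * (if j + 1 = m then 1 else 0)
      = pp v m * qq v L m := by
    cases m with
    | zero => simp [pp]
    | succ m =>
      simp only [add_left_inj, mul_ite, mul_one, mul_zero, Finset.sum_ite_eq', Finset.mem_range]
      rw [if_pos (by omega)]
  have h2 : ∑ j ∈ Finset.range L, pp v (j + 1) * qq v L (j + 1) * (if j = m + 1 then 1 else 0)
      = pp v (m + 2) * qq v L (m + 2) := by
    simp only [mul_ite, mul_one, mul_zero, Finset.sum_ite_eq', Finset.mem_range]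
    split_ifs with h
    · rfl
    · have : L = m + 1 := by omega
      subst this
      rw [qq_top]; ring
  have hsplit : ∑ j ∈ Finset.range L, pp v (j + 1) * qq v L (j + 1) * om v m j
      = (-1) ^ m * v m * (
        ∑ j ∈ Finset.range L, pp v (j + 1) * qq v L (j + 1) * ((-1) ^ j * v j) * (if j < m then 1 else 0)
        + ∑ j ∈ Finset.range L, pp v (j + 1) * qq v L (j + 1) * ((-1) ^ j * v j) * (if j < m + 1 then 1 else 0)
        - ∑ j ∈ Finset.range L, pp v (j + 1) * qq v L (j + 1) * ((-1) ^ j * v j))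
        + ∑ j ∈ Finset.range L, pp v (j + 1) * qq v L (j + 1) * (if j + 1 = m then 1 else 0)
        - ∑ j ∈ Finset.range L, pp v (j + 1) * qq v L (j + 1) * (if j = m + 1 then 1 else 0) := by
    rw [← Finset.sum_add_distrib, ← Finset.sum_sub_distrib, Finset.mul_sum,
      ← Finset.sum_add_distrib, ← Finset.sum_sub_distrib]
    refine Finset.sum_congr rfl fun j _ => ?_
    unfold om
    ring
  rw [hsplit, hres _ m hm.le, hres _ (m + 1) hm, h1, h2, S_zero v L hL, S_sum v L m hm.le,
    S_sum v L (m + 1) hm, qq_rec v L m hm, pp]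
  by_cases hk : Even m
  · have : ¬ Even (m + 1) := by simpa [Nat.even_add_one] using hk
    rw [if_pos hk, if_neg this, pow_succ, hk.neg_one_pow]
    ring
  · have : Even (m + 1) := by simpa [Nat.even_add_one] using hk
    rw [if_neg hk, if_pos this, pow_succ, (Nat.not_even_iff_odd.mp hk).neg_one_pow]
    ring

/-- the bracket as a derivation in the second argument -/
def brD {N : ℕ} (c : Fin N → Fin N → MvPolynomial (Fin N) ℂ) (f : MvPolynomial (Fin N) ℂ) :
    Derivation ℂ (MvPolynomial (Fin N) ℂ) (MvPolynomial (Fin N) ℂ) :=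
  ∑ i : Fin N, ∑ j : Fin N,
    if (i : ℕ) < (j : ℕ) then
      c i j • (pderiv i f • pderiv j - pderiv j f • pderiv i)
    else 0

theorem brD_apply {N : ℕ} (c : Fin N → Fin N → MvPolynomial (Fin N) ℂ)
    (f g : MvPolynomial (Fin N) ℂ) : brD c f g = pbracket c f g := by
  have hsum : ∀ (s : Fin N → Derivation ℂ (MvPolynomial (Fin N) ℂ) (MvPolynomial (Fin N) ℂ)),
      (∑ i, s i) g = ∑ i, s i g := by
    intro s
    rw [← Derivation.coeFnAddMonoidHom_apply, map_sum, Finset.sum_apply]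
    rfl
  unfold brD pbracket
  rw [hsum]
  refine Finset.sum_congr rfl fun i _ => ?_
  rw [hsum]
  refine Finset.sum_congr rfl fun j _ => ?_
  split_ifs <;> simp

theorem pbracket_antisymm {N : ℕ} (c : Fin N → Fin N → MvPolynomial (Fin N) ℂ)
    (f g : MvPolynomial (Fin N) ℂ) : pbracket c f g = - pbracket c g f := by
  unfold pbracket
  rw [← Finset.sum_neg_distrib]
  refine Finset.sum_congr rfl fun i _ => ?_
  rw [← Finset.sum_neg_distrib]
  refine Finset.sum_congr rfl fun j _ => ?_
  split_ifs
  · ring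
  · simp

theorem pbracket_X_lt {N : ℕ} (c : Fin N → Fin N → MvPolynomial (Fin N) ℂ)
    (a b : Fin N) (h : (a : ℕ) < b) : pbracket c (X a) (X b) = c a b := by
  unfold pbracket
  rw [Finset.sum_eq_single a, Finset.sum_eq_single b]
  · have : a ≠ b := by rintro rfl; omega
    simp [h, pderiv_X, Pi.single_apply, this, this.symm]
  · intro j _ hj
    have : a ≠ b := by rintro rfl; omega
    simp [pderiv_X, Pi.single_apply, this, this.symm, hj, hj.symm]
  · simp
  · intro i _ hi
    refine Finset.sum_eq_zero fun j _ => ?_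
    split_ifs with hij
    · by_cases hja : j = a
      · subst hja
        have : i ≠ b := by rintro rfl; omega
        simp [pderiv_X, Pi.single_apply, this, this.symm, hi, hi.symm]
      · simp [pderiv_X, Pi.single_apply, hi, hi.symm, hja, Ne.symm hja]
    · rfl
  · simp

theorem pbracket_self {N : ℕ} (c : Fin N → Fin N → MvPolynomial (Fin N) ℂ)
    (f : MvPolynomial (Fin N) ℂ) : pbracket c f f = 0 := by
  unfold pbracket
  refine Finset.sum_eq_zero fun i _ => Finset.sum_eq_zero fun j _ => ?_
  split_ifs
  · ring
  · rfl

theorem om_lt {N : ℕ} (a m j : ℕ) (hj : a + j < N) (h : m < j) :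
    pbracket (cSL N) (xvar N (a + m)) (xvar N (a + j))
      = om (fun t => xvar N (a + t)) m j := by
  have hm : a + m < N := by omega
  have h1 : ¬ j < m := by omega
  have h2 : ¬ j < m + 1 := by omega
  have h3 : ¬ j + 1 = m := by omega
  simp only [om, xvar, hj, hm, dif_pos, h1, h2, h3, if_false]
  rw [pbracket_X_lt _ _ _ (by simpa using h)]
  unfold cSL
  obtain ⟨d, rfl⟩ : ∃ d, j = m + d := ⟨j - m, by omega⟩
  have hs : ((-1 : MvPolynomial (Fin N) ℂ) ^ m) * (-1) ^ m = 1 := by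
    rw [← mul_pow]; simp
  by_cases hd : d = 1
  · subst hd
    simp only [add_assoc, if_true, pow_add]
    linear_combination (-(X ⟨a + m, hm⟩ * X ⟨a + (m + 1), hj⟩)) * hs
  · have e1 : ¬ (a + (m + d) = a + m + 1) := by omega
    have e2 : ¬ (m + d = m + 1) := by omega
    have e3 : a + (m + d) - (a + m) = d := by omega
    simp only [e1, e2, e3, if_false, pow_add]
    linear_combination ((-1) ^ d * (X ⟨a + m, hm⟩ * X ⟨a + (m + d), hj⟩)) * hs

theorem om_antisymm {R : Type*} [CommRing R] (v : ℕ → R) (m j : ℕ) (h : j < m) :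
    om v m j = - om v j m := by
  have h1 : ¬ m < j := by omega
  have h2 : ¬ m < j + 1 := by omega
  have h3 : j < m + 1 := by omega
  have h4 : ¬ m + 1 = j := by omega
  have h5 : ¬ j = m + 1 := by omega
  simp only [om, h, h1, h2, h3, h4, h5, if_true, if_false, eq_comm (a := m)]
  ring

theorem om_eq {N : ℕ} (a m j : ℕ) (hm : a + m < N) (hj : a + j < N) :
    pbracket (cSL N) (xvar N (a + m)) (xvar N (a + j))
      = om (fun t => xvar N (a + t)) m j := by
  rcases lt_trichotomy m j with h | h | h
  · exact om_lt a m j hj h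
  · subst h
    rw [pbracket_self]
    simp [om]
  · rw [pbracket_antisymm, om_lt a j m hm h, om_antisymm _ _ _ h]

theorem var_bracket {N : ℕ} (a L m : ℕ) (hL : Even L) (hm : m < L) (hN : a + L ≤ N) :
    pbracket (cSL N) (xvar N (a + m)) (pp (fun t => xvar N (a + t)) (L + 1))
      = (-1) ^ m * xvar N (a + m) * pp (fun t => xvar N (a + t)) (L + 1) := by
  rw [← brD_apply, dcont_sum, ← om_sum (fun t => xvar N (a + t)) L m hL hm]
  refine Finset.sum_congr rfl fun j hj => ?_
  rw [Finset.mem_range] at hj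
  rw [brD_apply, om_eq a m j (by omega) (by omega)]

theorem nested {N : ℕ} (a L b M : ℕ) (hL : Even L) (hM : Even M) (hb : b + M ≤ L)
    (hN : a + L ≤ N) :
    pbracket (cSL N) (pp (fun t => xvar N (a + t)) (L + 1))
      (pp (fun t => xvar N (a + b + t)) (M + 1)) = 0 := by
  rw [← brD_apply, dcont_sum]
  have := S_zero (fun t => xvar N (a + b + t)) M hM
  rw [← mul_zero (-(-1) ^ b * pp (fun t => xvar N (a + t)) (L + 1)), ← this, Finset.mul_sum]
  refine Finset.sum_congr rfl fun j hj => ?_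
  rw [Finset.mem_range] at hj
  rw [brD_apply, pbracket_antisymm, add_assoc a b j, var_bracket a L (b + j) hL (by omega) hN,
    pow_add]
  ring

theorem main_le (n k l : ℕ) (h : k ≤ l) (hln : l ≤ n) :
    pbracket (cSL (2 * n))
      (cont (fun t => xvar (2 * n) (n - l + t)) (2 * l))
      (cont (fun t => xvar (2 * n) (n - k + t)) (2 * k)) = 0 := by
  rw [(cont_eq_pp _ _).1, (cont_eq_pp _ _).1]
  have e : n - k = n - l + (l - k) := by omega
  rw [e]
  exact nested (n - l) (2 * l) (l - k) (2 * k) (even_two_mul l) (even_two_mul k) (by omega)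
    (by omega)

/-- The functions `y_k = E_{2k}(x_{n-k+1}, …, x_{n+k})`, `k = 1, …, n`, pairwise
Poisson commute with respect to the `SL(2, ℂ)` bracket on `ℂ[x₁, …, x_{2n}]`. -/
theorem stmt_9 (n : ℕ) (hn : 1 ≤ n) (k l : ℕ)
    (hk1 : 1 ≤ k) (hkn : k ≤ n) (hl1 : 1 ≤ l) (hln : l ≤ n) :
    pbracket (cSL (2 * n))
      (cont (fun t => xvar (2 * n) (n - k + t)) (2 * k))
      (cont (fun t => xvar (2 * n) (n - l + t)) (2 * l)) = 0 := by
  rcases le_total k l with h | h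
  · rw [pbracket_antisymm, main_le n k l h hln, neg_zero]
  · exact main_le n l k h hkn
end
end

section
/- Let N ≥ 1 and let {·,·} be the bracket on ℂ[x₁, …, x_N] determined as an antisymmetric biderivation by {x_i, x_{i+1}} = x_i x_{i+1} − 1 for 1 ≤ i ≤ N−1 and {x_i, x_j} = (−1)^{j−i+1} x_i x_j for 1 ≤ i < j ≤ N with j − i ≥ 2. For any 1 ≤ i ≤ j ≤ N let y = E_{j−i+1}(x_i, x_{i+1}, …, x_j), where E denotes the Euler continuants. Then y has complete Hamiltonian flow with quasi-polynomial components: for every p ∈ ℂ^N there exists a differentiable map γ : ℂ → ℂ^N with γ(0) = p and γ_k′(c) = {y, x_k}(γ(c)) for all c ∈ ℂ and all k = 1, …, N, and every component γ_k is a quasi-polynomial. -/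
noncomputable section

open MvPolynomial

/-- parity indicator -/
def wpar (R : Type*) [CommRing R] : ℕ → R
  | 0 => 0
  | (m + 1) => 1 - wpar R m

lemma wpar_cases (R : Type*) [CommRing R] (m : ℕ) :
    (wpar R m = 0 ∧ (-1 : R) ^ m = 1) ∨ (wpar R m = 1 ∧ (-1 : R) ^ m = -1) := by
  induction m with
  | zero => left; simp [wpar]
  | succ m ih =>
    rcases ih with ⟨h1, h2⟩ | ⟨h1, h2⟩
    · right; simp [wpar, h1, pow_succ, h2]
    · left; simp [wpar, h1, pow_succ, h2]

lemma cont_far {R : Type*} [CommRing R] [Algebra ℂ R] (D : Derivation ℂ R R) (v : ℕ → R) (x ε : R) (n : ℕ)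
    (h : ∀ t < n, D (v t) = ε * (-1) ^ t * (v t * x)) :
    ∀ m ≤ n, D (cont v m) = ε * wpar R m * (x * cont v m) := by
  intro m
  induction m using Nat.strong_induction_on with
  | _ m ih =>
    intro hm
    match m, ih, hm with
    | 0, _, _ => simp [cont, wpar]
    | 1, _, hm => simp [cont, wpar, h 0 (by omega)]; ring
    | m + 2, ih, hm =>
      have h0 := ih m (by omega) (by omega)
      have h1 := ih (m + 1) (by omega) (by omega)
      simp only [cont, map_sub, Derivation.leibniz, smul_eq_mul, h0, h1, h (m + 1) (by omega)]
      rcases wpar_cases R m with ⟨e1, e2⟩ | ⟨e1, e2⟩ <;> simp [wpar, e1, e2, pow_succ] <;> ring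

lemma cont_right {R : Type*} [CommRing R] [Algebra ℂ R] (D : Derivation ℂ R R) (v : ℕ → R) (x : R) (m : ℕ)
    (h : ∀ t < m, D (v t) = (-1) ^ (m + t) * (v t * x)) (hm : D (v m) = v m * x - 1) :
    D (cont v (m + 1)) = wpar R (m + 1) * (x * cont v (m + 1)) - cont v m := by
  match m, h, hm with
  | 0, _, hm => simp [cont, wpar, hm]; ring
  | m + 1, h, hm =>
    have hf := cont_far D v x ((-1) ^ (m + 1)) (m + 1)
      (fun t ht => by rw [h t ht, pow_add])
    simp only [cont, map_sub, Derivation.leibniz, smul_eq_mul, hf m (by omega),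
      hf (m + 1) le_rfl, hm]
    rcases wpar_cases R m with ⟨e1, e2⟩ | ⟨e1, e2⟩ <;> simp [wpar, e1, e2, pow_succ] <;> ring

lemma cont_left {R : Type*} [CommRing R] [Algebra ℂ R] (D : Derivation ℂ R R) (v : ℕ → R) (x : R) (n : ℕ)
    (h0 : D (v 0) = - (v 0 * x - 1))
    (h : ∀ t < n, D (v (t + 1)) = (-1) ^ t * (v (t + 1) * x)) :
    ∀ m ≤ n, D (cont v (m + 1)) = - wpar R (m + 1) * (x * cont v (m + 1))
      + cont (fun t => v (t + 1)) m := by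
  intro m
  induction m using Nat.strong_induction_on with
  | _ m ih =>
    intro hm
    match m, ih, hm with
    | 0, _, _ => simp [cont, wpar, h0]; ring
    | 1, _, hm => simp [cont, wpar, h0, h 0 (by omega)]; ring
    | m + 2, ih, hm =>
      have g0 := ih m (by omega) (by omega)
      have g1 := ih (m + 1) (by omega) (by omega)
      have e : cont v (m + 2 + 1) = v (m + 2) * cont v (m + 1 + 1) - cont v (m + 1) := rfl
      have e' : cont (fun t => v (t + 1)) (m + 2) = v (m + 2) * cont (fun t => v (t + 1)) (m + 1)
        - cont (fun t => v (t + 1)) m := rfl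
      rw [e, e']
      simp only [map_sub, Derivation.leibniz, smul_eq_mul, g0, g1, h (m + 1) (by omega)]
      rcases wpar_cases R m with ⟨e1, e2⟩ | ⟨e1, e2⟩ <;> simp [wpar, e1, e2, pow_succ] <;> ring

lemma cont_mid_aux {R : Type*} [CommRing R] [Algebra ℂ R] (D : Derivation ℂ R R) (v : ℕ → R) (r s : ℕ) (P : R)
    (hP : cont v (r + 1) = v r * cont v r - P)
    (hDP : D P = (wpar R r - 1) * (v r * P))
    (hDC : D (cont v r) = wpar R r * (v r * cont v r) - P)
    (h0 : D (v r) = 0) (h1 : 0 < s → D (v (r + 1)) = - (v (r + 1) * v r - 1))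
    (h : ∀ t, t + 1 < s → D (v (r + t + 2)) = (-1) ^ t * (v (r + t + 2) * v r)) :
    ∀ m ≤ s, D (cont v (r + m + 1)) = (wpar R r - wpar R m) * (v r * cont v (r + m + 1)) := by
  have H0 : D (cont v (r + 1)) = wpar R r * (v r * cont v (r + 1)) := by
    rw [hP]
    simp only [map_sub, Derivation.leibniz, smul_eq_mul, hDP, hDC, h0]; ring
  intro m
  induction m using Nat.strong_induction_on with
  | _ m ih =>
    intro hm
    match m, ih, hm with
    | 0, _, _ => simpa [wpar] using H0
    | 1, _, hm =>
      have e : cont v (r + 1 + 1) = v (r + 1) * cont v (r + 1) - cont v r := rfl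
      rw [e]
      simp only [map_sub, Derivation.leibniz, smul_eq_mul, H0, hDC, h1 (by omega), wpar]
      rw [hP]; ring
    | m + 2, ih, hm =>
      have g0 := ih m (by omega) (by omega)
      have g1 := ih (m + 1) (by omega) (by omega)
      have e : cont v (r + (m + 2) + 1) =
        v (r + m + 2) * cont v (r + (m + 1) + 1) - cont v (r + m + 1) := rfl
      rw [e]
      simp only [map_sub, Derivation.leibniz, smul_eq_mul, g0, g1, h m (by omega)]
      rcases wpar_cases R m with ⟨e1, e2⟩ | ⟨e1, e2⟩ <;> simp [wpar, e1, e2] <;> ring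

lemma wpar_add (R : Type*) [CommRing R] (r m : ℕ) :
    wpar R r - wpar R m = - (-1) ^ r * (1 - wpar R (r + m + 1)) := by
  induction m with
  | zero =>
    rcases wpar_cases R r with ⟨e1, e2⟩ | ⟨e1, e2⟩ <;> simp [wpar, e1, e2]
  | succ m ih =>
    have e : wpar R (r + (m + 1) + 1) = 1 - wpar R (r + m + 1) := rfl
    rw [e]
    have e' : wpar R (m + 1) = 1 - wpar R m := rfl
    rw [e']
    rcases wpar_cases R r with ⟨e1, e2⟩ | ⟨e1, e2⟩ <;> rw [e1, e2] at ih ⊢ <;>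
      linear_combination -ih

lemma cont_mid {R : Type*} [CommRing R] [Algebra ℂ R] (D : Derivation ℂ R R) (v : ℕ → R) (r n : ℕ) (hr : r < n)
    (ha : ∀ t, t + 1 < r → D (v t) = (-1) ^ (r + t + 1) * (v t * v r))
    (hb : ∀ t, t + 1 = r → D (v t) = v t * v r - 1)
    (h0 : D (v r) = 0) (h1 : r + 1 < n → D (v (r + 1)) = - (v (r + 1) * v r - 1))
    (h : ∀ t, r + 1 < t → t < n → D (v t) = (-1) ^ (r + t) * (v t * v r)) :
    D (cont v n) = - (-1) ^ r * (1 - wpar R n) * (v r * cont v n) := by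
  obtain ⟨s, rfl⟩ : ∃ s, n = r + s + 1 := ⟨n - r - 1, by omega⟩
  rw [← wpar_add]
  have h1' : 0 < s → D (v (r + 1)) = - (v (r + 1) * v r - 1) := fun hs => h1 (by omega)
  have h' : ∀ t, t + 1 < s → D (v (r + t + 2)) = (-1) ^ t * (v (r + t + 2) * v r) := by
    intro t ht
    rw [h _ (by omega) (by omega)]
    congr 1
    rw [show r + (r + t + 2) = 2 * (r + 1) + t by ring, pow_add, pow_mul]; simp
  match r, ha, hb, h0, h1', h' with
  | 0, ha, hb, h0, h1', h' =>
    exact cont_mid_aux D v 0 s 0 (by simp [cont]) (by simp) (by simp [cont, wpar]) h0 h1' h' s le_rfl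
  | r + 1, ha, hb, h0, h1', h' =>
    have ha' : ∀ t < r, D (v t) = (-1) ^ (r + t) * (v t * v (r + 1)) := by
      intro t ht
      rw [ha t (by omega)]
      congr 1
      rw [show r + 1 + t + 1 = (r + t) + 2 by ring, pow_add]; simp
    refine cont_mid_aux D v (r + 1) s (cont v r) rfl ?_ ?_ h0 h1' h' s le_rfl
    · rw [cont_far D v (v (r + 1)) ((-1) ^ r) r (fun t ht => by rw [ha' t ht, pow_add]) r le_rfl]
      rcases wpar_cases R r with ⟨e1, e2⟩ | ⟨e1, e2⟩ <;> simp [wpar, e1, e2]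
    · exact cont_right D v (v (r + 1)) r ha' (hb r rfl)

/-- Hamiltonian derivation -/
def hamD (N : ℕ) (k : Fin N) : Derivation ℂ (MvPolynomial (Fin N) ℂ) (MvPolynomial (Fin N) ℂ) :=
  ∑ i : Fin N, ∑ j : Fin N,
    if (i : ℕ) < (j : ℕ) then
      (cSL N i j * pderiv j (X k)) • pderiv i - (cSL N i j * pderiv i (X k)) • pderiv j
    else 0

lemma hamD_eq (N : ℕ) (k : Fin N) (f : MvPolynomial (Fin N) ℂ) :
    pbracket (cSL N) f (X k) = hamD N k f := by
  have e : ∀ g : Fin N → Derivation ℂ (MvPolynomial (Fin N) ℂ) (MvPolynomial (Fin N) ℂ),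
      (∑ i, g i) f = ∑ i, g i f := fun g => by
    rw [← Derivation.coeFnAddMonoidHom_apply, map_sum, Finset.sum_apply]; rfl
  unfold pbracket hamD
  rw [e]
  refine Finset.sum_congr rfl fun i _ => ?_
  rw [e]
  refine Finset.sum_congr rfl fun j _ => ?_
  split_ifs
  · simp only [Derivation.sub_apply, Derivation.smul_apply, smul_eq_mul]; ring
  · simp

lemma hamD_X (N : ℕ) (k l : Fin N) :
    hamD N k (X l) = if (l : ℕ) < k then cSL N l k else if (k : ℕ) < l then - cSL N k l else 0 := by
  rw [← hamD_eq]
  unfold pbracket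
  have e : ∀ i j : Fin N, (if (i : ℕ) < (j : ℕ) then
      cSL N i j * (pderiv i (X l) * pderiv j (X k) - pderiv j (X l) * pderiv i (X k)) else 0)
      = (if i = l then if j = k then if (l : ℕ) < k then cSL N l k else 0 else 0 else 0) -
        (if i = k then if j = l then if (k : ℕ) < l then cSL N k l else 0 else 0 else 0) := by
    intro i j
    simp only [pderiv_X, Pi.single_apply]
    by_cases h1 : i = l <;> by_cases h2 : j = k <;> by_cases h3 : i = k <;> by_cases h4 : j = l <;>
      subst_vars <;> simp_all [eq_comm] <;> split_ifs <;> simp_all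
  simp only [e, Finset.sum_sub_distrib, Finset.sum_ite_eq', Finset.mem_univ, if_true]
  split_ifs <;> first | omega | simp

lemma cont_map {R S : Type*} [CommRing R] [CommRing S] (f : R →+* S) (v : ℕ → R) :
    ∀ m, f (cont v m) = cont (fun t => f (v t)) m
  | 0 => by simp [cont]
  | 1 => by simp [cont]
  | m + 2 => by simp [cont, cont_map f v m, cont_map f v (m + 1)]

lemma cont_scale (v v' : ℕ → ℂ) (μ : ℂ) (n : ℕ)
    (h : ∀ t < n, v' t = v t * Complex.exp ((-1) ^ t * μ)) :
    ∀ m ≤ n, cont v' m = cont v m * Complex.exp (wpar ℂ m * μ) := by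
  intro m
  induction m using Nat.strong_induction_on with
  | _ m ih =>
    intro hm
    match m, ih, hm with
    | 0, _, _ => simp [cont, wpar]
    | 1, _, hm => simp [cont, wpar, h 0 (by omega)]
    | m + 2, ih, hm =>
      have h0 := ih m (by omega) (by omega)
      have h1 := ih (m + 1) (by omega) (by omega)
      simp only [cont, h0, h1, h (m + 1) (by omega)]
      have h3 : Complex.exp (-μ) * Complex.exp μ = 1 := by rw [← Complex.exp_add]; simp
      rcases wpar_cases ℂ m with ⟨e1, e2⟩ | ⟨e1, e2⟩ <;> simp [wpar, e1, e2, pow_succ]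
      · linear_combination (v (m + 1) * cont v (m + 1)) * h3
      · ring

/-- explicit solution of `f' = α f + C e^{β t}` -/
def sol (p α C β : ℂ) (t : ℂ) : ℂ :=
  if α = β then (p + C * t) * Complex.exp (α * t)
  else (p - C / (β - α)) * Complex.exp (α * t) + C / (β - α) * Complex.exp (β * t)

lemma sol_zero (p α C β : ℂ) : sol p α C β 0 = p := by
  unfold sol; split_ifs <;> simp

lemma sol_hom (p α β t : ℂ) : sol p α 0 β t = p * Complex.exp (α * t) := by
  unfold sol; split_ifs <;> simp

lemma sol_deriv (p α C β t : ℂ) :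
    HasDerivAt (sol p α C β) (α * sol p α C β t + C * Complex.exp (β * t)) t := by
  have he : ∀ a : ℂ, HasDerivAt (fun s => Complex.exp (a * s)) (Complex.exp (a * t) * a) t := by
    intro a
    simpa using ((hasDerivAt_id t).const_mul a).cexp
  by_cases h : α = β
  · subst h
    have e : sol p α C α = fun t => (p + C * t) * Complex.exp (α * t) := by
      funext t; simp [sol]
    rw [e]
    have h1 : HasDerivAt (fun s => p + C * s) C t := by
      simpa using ((hasDerivAt_id t).const_mul C).const_add p
    refine (h1.mul (he α)).congr_deriv ?_
    ring
  · have e : sol p α C β = fun t => (p - C / (β - α)) * Complex.exp (α * t)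
        + C / (β - α) * Complex.exp (β * t) := by
      funext t; simp [sol, h]
    rw [e]
    have h' : β - α ≠ 0 := fun h2 => h (by linear_combination -h2)
    refine (((he α).const_mul (p - C / (β - α))).add ((he β).const_mul (C / (β - α)))).congr_deriv ?_
    field_simp
    ring

lemma sol_quasi (p α C β : ℂ) : IsQuasiPolynomial (sol p α C β) := by
  by_cases h : α = β
  · refine ⟨1, fun _ => Polynomial.C p + Polynomial.C C * Polynomial.X, fun _ => α, fun c => ?_⟩
    simp [sol, h]
  · refine ⟨2, ![Polynomial.C (p - C / (β - α)), Polynomial.C (C / (β - α))], ![α, β], fun c => ?_⟩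
    simp [sol, h, Fin.sum_univ_two]

lemma hamD_xvar (N : ℕ) (k : Fin N) (l : ℕ) (hl : l < N) :
    hamD N k (xvar N l) =
      if l < k then (if (k : ℕ) = l + 1 then xvar N l * X k - 1
        else (-1) ^ ((k : ℕ) - l + 1) * (xvar N l * X k))
      else if (k : ℕ) < l then (if l = k + 1 then - (xvar N l * X k - 1)
        else - ((-1) ^ (l - (k : ℕ) + 1) * (xvar N l * X k))) else 0 := by
  have e : xvar N l = X ⟨l, hl⟩ := by simp [xvar, hl]
  rw [e, hamD_X]
  unfold cSL
  split_ifs <;> first | rfl | (rw [mul_comm (X k)])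

/-- weight -/
def wt (R : Type*) [CommRing R] (a n k : ℕ) : R :=
  if k < a then (-1) ^ (a - k) * wpar R n
  else if k < a + n then - (-1) ^ (k - a) * (1 - wpar R n)
  else (-1) ^ (k - a + 1) * wpar R n

/-- inhomogeneous term -/
def nb {R : Type*} [CommRing R] (v : ℕ → R) (a n k : ℕ) : R :=
  if k + 1 = a then cont (fun t => v (t + 1)) (n - 1)
  else if k = a + n then - cont v (n - 1) else 0

lemma neg_one_pow_par {R : Type*} [CommRing R] {m n : ℕ} (h : m % 2 = n % 2) :
    (-1 : R) ^ m = (-1) ^ n := by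
  rw [← Nat.div_add_mod m 2, ← Nat.div_add_mod n 2, pow_add, pow_add, pow_mul, pow_mul, h]; simp

lemma neg_one_pow_par' {R : Type*} [CommRing R] {m n : ℕ} (h : m % 2 = (n + 1) % 2) :
    (-1 : R) ^ m = - (-1) ^ n := by
  rw [neg_one_pow_par h, pow_succ]; ring

lemma hamD_cont (N a n : ℕ) (hn : 0 < n) (ha : a + n ≤ N) (k : Fin N) :
    hamD N k (cont (fun t => xvar N (a + t)) n) =
      wt _ a n k * (X k * cont (fun t => xvar N (a + t)) n)
        + nb (fun t => xvar N (a + t)) a n k := by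
  set v : ℕ → MvPolynomial (Fin N) ℂ := fun t => xvar N (a + t) with hv
  have hx : ∀ t, t < n → hamD N k (v t) = _ := fun t ht => hamD_xvar N k (a + t) (by omega)
  rcases lt_or_ge (k : ℕ) a with hk | hk
  · by_cases hk1 : (k : ℕ) + 1 = a
    · obtain ⟨m, rfl⟩ : ∃ m, n = m + 1 := ⟨n - 1, by omega⟩
      have := cont_left (hamD N k) v (X k) m
        (by rw [hx 0 (by omega), if_neg (by omega), if_pos (by omega), if_pos (by omega)])
        (by
          intro t ht
          rw [hx (t + 1) (by omega), if_neg (by omega), if_pos (by omega), if_neg (by omega),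
            neg_one_pow_par' (n := t) (by omega)]
          ring) m le_rfl
      rw [this]
      simp [wt, nb, hk, hk1, show a - (k : ℕ) = 1 by omega]
    · have := cont_far (hamD N k) v (X k) ((-1) ^ (a - (k : ℕ))) n
        (by
          intro t ht
          rw [hx t (by omega), if_neg (by omega), if_pos (by omega), if_neg (by omega), ← pow_add,
            neg_one_pow_par' (n := a - (k : ℕ) + t) (by omega)]
          ring) n le_rfl
      rw [this]
      simp [wt, nb, hk, hk1, show (k : ℕ) ≠ a + n by omega]
  · rcases lt_or_ge (k : ℕ) (a + n) with hk2 | hk2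
    · obtain ⟨r, hr⟩ : ∃ r, (k : ℕ) = a + r := ⟨k - a, by omega⟩
      have hvr : X k = v r := by simp [hv, xvar, ← hr]
      have := cont_mid (hamD N k) v r n (by omega)
        (by
          intro t ht
          rw [hx t (by omega), if_pos (by omega), if_neg (by omega), hvr,
            neg_one_pow_par (n := r + t + 1) (by omega)])
        (by
          intro t ht
          rw [hx t (by omega), if_pos (by omega), if_pos (by omega), hvr])
        (by rw [hx r (by omega), if_neg (by omega), if_neg (by omega)])
        (by
          intro h
          rw [hx (r + 1) (by omega), if_neg (by omega), if_pos (by omega), if_pos (by omega), hvr])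
        (by
          intro t h1 h2
          rw [hx t (by omega), if_neg (by omega), if_pos (by omega), if_neg (by omega), hvr,
            neg_one_pow_par' (n := r + t) (by omega)]
          ring)
      rw [this, hvr, wt, nb, if_neg (by omega), if_pos (by omega), if_neg (by omega),
        if_neg (by omega), show (k : ℕ) - a = r by omega, add_zero]
    · by_cases hk1 : (k : ℕ) = a + n
      · obtain ⟨m, rfl⟩ : ∃ m, n = m + 1 := ⟨n - 1, by omega⟩
        have := cont_right (hamD N k) v (X k) m
          (by
            intro t ht
            rw [hx t (by omega), if_pos (by omega), if_neg (by omega),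
              neg_one_pow_par (n := m + t) (by omega)])
          (by rw [hx m (by omega), if_pos (by omega), if_pos (by omega)])
        rw [this, wt, nb, if_neg (by omega), if_neg (by omega), if_neg (by omega),
          if_pos (by omega), show (k : ℕ) - a + 1 = m + 2 by omega]
        rcases wpar_cases (MvPolynomial (Fin N) ℂ) m with ⟨e1, e2⟩ | ⟨e1, e2⟩ <;>
          simp [wpar, e1, e2, pow_succ] <;> ring
      · have := cont_far (hamD N k) v (X k) ((-1) ^ ((k : ℕ) - a + 1)) n
          (by
            intro t ht
            rw [hx t (by omega), if_pos (by omega), if_neg (by omega), ← pow_add,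
              neg_one_pow_par (n := (k : ℕ) - a + 1 + t) (by omega)]) n le_rfl
        rw [this, wt, nb, if_neg (by omega), if_neg (by omega), if_neg (by omega),
          if_neg (by omega), add_zero]

lemma map_wpar {R S : Type*} [CommRing R] [CommRing S] (f : R →+* S) (m : ℕ) :
    f (wpar R m) = wpar S m := by
  induction m with
  | zero => simp [wpar]
  | succ m ih => simp [wpar, ih]

lemma map_wt {R S : Type*} [CommRing R] [CommRing S] (f : R →+* S) (a n k : ℕ) :
    f (wt R a n k) = wt S a n k := by
  unfold wt
  split_ifs <;> simp [map_wpar]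

lemma map_nb {R S : Type*} [CommRing R] [CommRing S] (f : R →+* S) (v : ℕ → R) (a n k : ℕ) :
    f (nb v a n k) = nb (fun t => f (v t)) a n k := by
  unfold nb
  split_ifs <;> simp [cont_map]

/-- For `1 ≤ i ≤ j ≤ N`, the Euler continuant `y = E_{j-i+1}(xᵢ, …, xⱼ)` has
complete Hamiltonian flow with quasi-polynomial components with respect to the
`SL(2, ℂ)` bracket on `ℂ[x₁, …, x_N]`. -/
theorem stmt_10 (N : ℕ) (hN : 1 ≤ N) (i j : ℕ)
    (h1i : 1 ≤ i) (hij : i ≤ j) (hjN : j ≤ N) (p : Fin N → ℂ) :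
    ∃ γ : ℂ → Fin N → ℂ, γ 0 = p ∧
      (∀ (c : ℂ) (k : Fin N), HasDerivAt (fun t => γ t k)
        (MvPolynomial.eval (γ c)
          (pbracket (cSL N) (cont (fun t => xvar N (i - 1 + t)) (j - i + 1)) (X k))) c) ∧
      (∀ k : Fin N, IsQuasiPolynomial fun c => γ c k) := by
  set a := i - 1 with ha
  set n := j - i + 1 with hn
  have hn0 : 0 < n := by omega
  have han : a + n ≤ N := by omega
  clear_value a n
  set pv : ℕ → ℂ := fun t => MvPolynomial.eval p (xvar N (a + t)) with hpv
  set Y := cont pv n with hY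
  set β : ℕ → ℂ := fun k => if k + 1 = a then wpar ℂ (n - 1) * ((1 - wpar ℂ n) * Y)
    else wpar ℂ (n - 1) * (-(1 - wpar ℂ n) * Y) with hβ
  set γ : ℂ → Fin N → ℂ := fun c k => sol (p k) (wt ℂ a n k * Y) (nb pv a n k) (β k) c with hγ
  refine ⟨γ, ?_, ?_, fun k => sol_quasi _ _ _ _⟩
  · funext k; exact sol_zero _ _ _ _
  · intro c k
    refine (sol_deriv (p k) (wt ℂ a n k * Y) (nb pv a n k) (β k) c).congr_deriv ?_
    rw [hamD_eq, hamD_cont N a n hn0 han k, map_add, map_mul, map_mul, map_wt, map_nb, cont_map,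
      eval_X]
    have hs : ∀ t < n, MvPolynomial.eval (γ c) (xvar N (a + t)) =
        pv t * Complex.exp ((-1) ^ t * (-(1 - wpar ℂ n) * Y * c)) := by
      intro t ht
      have hlt : a + t < N := by omega
      simp only [hpv, hγ, xvar, hlt, dif_pos, eval_X]
      have h0 : ∀ w : ℕ → ℂ, nb w a n (a + t) = 0 := by
        intro w
        rw [nb, if_neg (by omega), if_neg (by omega)]
      rw [h0, sol_hom, wt, if_neg (by omega), if_pos (by omega), show a + t - a = t by omega]
      congr 2
      ring
    have hc := cont_scale pv (fun t => MvPolynomial.eval (γ c) (xvar N (a + t))) _ n hs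
    have hYc : cont (fun t => MvPolynomial.eval (γ c) (xvar N (a + t))) n = Y := by
      rw [hc n le_rfl]
      rcases wpar_cases ℂ n with ⟨e1, _⟩ | ⟨e1, _⟩ <;> simp [e1, hY]
    have hnb : nb (fun t => MvPolynomial.eval (γ c) (xvar N (a + t))) a n k =
        nb pv a n k * Complex.exp (β k * c) := by
      unfold nb
      simp only [hβ]
      split_ifs with h1 h2
      · rw [cont_scale (fun t => pv (t + 1)) _ ((1 - wpar ℂ n) * Y * c) (n - 1) _ (n - 1) le_rfl]
        · congr 2; ring
        · intro t ht
          rw [hs (t + 1) (by omega)]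
          congr 2; ring
      · rw [hc (n - 1) (by omega), neg_mul]
        congr 3; ring
      · simp
    rw [hYc, hnb]
    simp only [hγ]
    ring
end
end

section
/- Let {·,·} be the bracket on ℂ[x₁, x₂, x₃, x₄] determined as an antisymmetric biderivation by {x₁,x₂} = x₁x₂ − 1, {x₂,x₃} = x₂x₃ − 1, {x₃,x₄} = x₃x₄ − 1, {x₁,x₃} = −x₁x₃, {x₂,x₄} = −x₂x₄, {x₁,x₄} = x₁x₄. Put y₁ = x₂x₃ − 1 and y₂ = x₁x₂x₃x₄ − x₁x₂ − x₁x₄ − x₃x₄ + 1. For p = (x₁, x₂, x₃, x₄) ∈ ℂ⁴, writing y₁ and y₂ also for the values y₁(p), y₂(p): (a) if y₁ = 0, the curve γ₁(c) = (x₁ + c x₃, x₂, x₃, x₄ − c x₂), and if y₁ ≠ 0, the curve γ₁(c) = (x₁ + x₃(e^{c y₁} − 1)/y₁, e^{−c y₁} x₂, e^{c y₁} x₃, x₄ + x₂(e^{−c y₁} − 1)/y₁), satisfies γ₁(0) = p and γ₁′(c)_j = {y₁, x_j}(γ₁(c)) for all c ∈ ℂ and j = 1,…,4; (b) the curve γ₂(c)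 = (x₁ e^{−c y₂}, x₂ e^{c y₂}, x₃ e^{−c y₂}, x₄ e^{c y₂}) satisfies γ₂(0) = p and γ₂′(c)_j = {y₂, x_j}(γ₂(c)) for all c ∈ ℂ and j = 1,…,4. -/
noncomputable section

open MvPolynomial

/-- Coefficients of the bracket on `ℂ[x₁, x₂, x₃, x₄]`:
`{x₁,x₂} = x₁x₂ - 1`, `{x₂,x₃} = x₂x₃ - 1`, `{x₃,x₄} = x₃x₄ - 1`,
`{x₁,x₃} = -x₁x₃`, `{x₂,x₄} = -x₂x₄`, `{x₁,x₄} = x₁x₄`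
(variables `x₁, x₂, x₃, x₄` are `X 0, X 1, X 2, X 3`). -/
def c4 : Fin 4 → Fin 4 → MvPolynomial (Fin 4) ℂ := fun i j =>
  if i = 0 ∧ j = 1 then X 0 * X 1 - 1
  else if i = 1 ∧ j = 2 then X 1 * X 2 - 1
  else if i = 2 ∧ j = 3 then X 2 * X 3 - 1
  else if i = 0 ∧ j = 2 then -(X 0 * X 2)
  else if i = 1 ∧ j = 3 then -(X 1 * X 3)
  else if i = 0 ∧ j = 3 then X 0 * X 3
  else 0

/-- `y₁ = x₂x₃ - 1`. -/
def y1p : MvPolynomial (Fin 4) ℂ := X 1 * X 2 - 1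

/-- `y₂ = x₁x₂x₃x₄ - x₁x₂ - x₁x₄ - x₃x₄ + 1`. -/
def y2p : MvPolynomial (Fin 4) ℂ :=
  X 0 * X 1 * X 2 * X 3 - X 0 * X 1 - X 0 * X 3 - X 2 * X 3 + 1

/-- The integral curve of `H_{y₁}` through `p` when `y₁(p) = 0`. -/
def gamma1A (p : Fin 4 → ℂ) (c : ℂ) : Fin 4 → ℂ :=
  ![p 0 + c * p 2, p 1, p 2, p 3 - c * p 1]

/-- The integral curve of `H_{y₁}` through `p` when `y₁(p) ≠ 0`
(here `y₁ = p 1 * p 2 - 1` denotes the value `y₁(p)`). -/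
def gamma1B (p : Fin 4 → ℂ) (c : ℂ) : Fin 4 → ℂ :=
  ![p 0 + p 2 * (Complex.exp (c * (p 1 * p 2 - 1)) - 1) / (p 1 * p 2 - 1),
    Complex.exp (-(c * (p 1 * p 2 - 1))) * p 1,
    Complex.exp (c * (p 1 * p 2 - 1)) * p 2,
    p 3 + p 1 * (Complex.exp (-(c * (p 1 * p 2 - 1))) - 1) / (p 1 * p 2 - 1)]

/-- The integral curve of `H_{y₂}` through `p`
(here `y₂` denotes the value `y₂(p)`). -/
def gamma2 (p : Fin 4 → ℂ) (c : ℂ) : Fin 4 → ℂ :=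
  ![p 0 * Complex.exp (-(c * (p 0 * p 1 * p 2 * p 3 - p 0 * p 1 - p 0 * p 3 - p 2 * p 3 + 1))),
    p 1 * Complex.exp (c * (p 0 * p 1 * p 2 * p 3 - p 0 * p 1 - p 0 * p 3 - p 2 * p 3 + 1)),
    p 2 * Complex.exp (-(c * (p 0 * p 1 * p 2 * p 3 - p 0 * p 1 - p 0 * p 3 - p 2 * p 3 + 1))),
    p 3 * Complex.exp (c * (p 0 * p 1 * p 2 * p 3 - p 0 * p 1 - p 0 * p 3 - p 2 * p 3 + 1))]

theorem eval_y1 (q : Fin 4 → ℂ) (j : Fin 4) :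
    MvPolynomial.eval q (pbracket c4 y1p (X j)) =
      ![q 2, -(q 1 * q 2 - 1) * q 1, (q 1 * q 2 - 1) * q 2, -q 1] j := by
  fin_cases j <;>
    simp [pbracket, Fin.sum_univ_four, c4, y1p, pderiv_X, Pi.single_apply] <;> ring

theorem eval_y2 (q : Fin 4 → ℂ) (j : Fin 4) :
    MvPolynomial.eval q (pbracket c4 y2p (X j)) =
      (q 0 * q 1 * q 2 * q 3 - q 0 * q 1 - q 0 * q 3 - q 2 * q 3 + 1) *
      ![-q 0, q 1, -q 2, q 3] j := by
  fin_cases j <;>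
    simp [pbracket, Fin.sum_univ_four, c4, y2p, pderiv_X, Pi.single_apply] <;> ring

theorem hasDerivAt_e (y c : ℂ) :
    HasDerivAt (fun t => Complex.exp (t * y)) (Complex.exp (c * y) * y) c := by
  simpa using ((hasDerivAt_id c).mul_const y).cexp

theorem hasDerivAt_e' (y c : ℂ) :
    HasDerivAt (fun t => Complex.exp (-(t * y))) (-(Complex.exp (-(c * y)) * y)) c := by
  simpa using ((hasDerivAt_id c).mul_const y).neg.cexp

/-- The explicit curves `γ₁` (in its two cases) and `γ₂` are the integral
curves through `p` of the Hamiltonian vector fields of `y₁` and `y₂`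
respectively. -/
theorem stmt_11 (p : Fin 4 → ℂ) :
    ((p 1 * p 2 - 1 = 0) →
      gamma1A p 0 = p ∧
      ∀ (c : ℂ) (j : Fin 4), HasDerivAt (fun t => gamma1A p t j)
        (MvPolynomial.eval (gamma1A p c) (pbracket c4 y1p (X j))) c) ∧
    ((p 1 * p 2 - 1 ≠ 0) →
      gamma1B p 0 = p ∧
      ∀ (c : ℂ) (j : Fin 4), HasDerivAt (fun t => gamma1B p t j)
        (MvPolynomial.eval (gamma1B p c) (pbracket c4 y1p (X j))) c) ∧
    (gamma2 p 0 = p ∧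
      ∀ (c : ℂ) (j : Fin 4), HasDerivAt (fun t => gamma2 p t j)
        (MvPolynomial.eval (gamma2 p c) (pbracket c4 y2p (X j))) c) := by
  refine ⟨fun h => ⟨?_, fun c j => ?_⟩, fun h => ⟨?_, fun c j => ?_⟩, ?_, fun c j => ?_⟩
  · ext j; fin_cases j <;> simp [gamma1A]
  · rw [eval_y1]
    fin_cases j
    · simpa [gamma1A] using ((hasDerivAt_id c).mul_const (p 2)).const_add (p 0)
    · simpa [gamma1A, h] using hasDerivAt_const c (p 1)
    · simpa [gamma1A, h] using hasDerivAt_const c (p 2)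
    · simpa [gamma1A] using ((hasDerivAt_id c).mul_const (p 1)).const_sub (p 3)
  · ext j; fin_cases j <;> simp [gamma1B]
  · rw [eval_y1]
    have hE : Complex.exp (-(c * (p 1 * p 2 - 1))) * Complex.exp (c * (p 1 * p 2 - 1)) = 1 := by
      rw [← Complex.exp_add]; simp
    have h1 := hasDerivAt_e (p 1 * p 2 - 1) c
    have h2 := hasDerivAt_e' (p 1 * p 2 - 1) c
    fin_cases j
    · refine ((((h1.sub_const 1).const_mul (p 2)).div_const
        (p 1 * p 2 - 1)).const_add (p 0)).congr_deriv ?_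
      simp [gamma1B]
      rw [← mul_assoc, mul_div_cancel_right₀ _ h]; ring
    · refine (h2.mul_const (p 1)).congr_deriv ?_
      simp [gamma1B]
      linear_combination (Complex.exp (-(c * (p 1 * p 2 - 1))) * p 1 ^ 2 * p 2) * hE
    · refine (h1.mul_const (p 2)).congr_deriv ?_
      simp [gamma1B]
      linear_combination (-(Complex.exp (c * (p 1 * p 2 - 1)) * p 1 * p 2 ^ 2)) * hE
    · refine ((((h2.sub_const 1).const_mul (p 1)).div_const
        (p 1 * p 2 - 1)).const_add (p 3)).congr_deriv ?_
      simp [gamma1B]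
      field_simp
  · ext j; fin_cases j <;> simp [gamma2]
  · rw [eval_y2]
    have hY : gamma2 p c 0 * gamma2 p c 1 * gamma2 p c 2 * gamma2 p c 3
        - gamma2 p c 0 * gamma2 p c 1 - gamma2 p c 0 * gamma2 p c 3
        - gamma2 p c 2 * gamma2 p c 3 + 1
        = p 0 * p 1 * p 2 * p 3 - p 0 * p 1 - p 0 * p 3 - p 2 * p 3 + 1 := by
      simp only [gamma2]
      generalize hy : p 0 * p 1 * p 2 * p 3 - p 0 * p 1 - p 0 * p 3 - p 2 * p 3 + 1 = y
      have hE : Complex.exp (-(c * y)) * Complex.exp (c * y) = 1 := by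
        rw [← Complex.exp_add]; simp
      simp
      generalize Complex.exp (-(c * y)) = a at *
      generalize Complex.exp (c * y) = b at *
      linear_combination (p 0 * p 1 * p 2 * p 3 * (a * b + 1) - p 0 * p 1 - p 0 * p 3
        - p 2 * p 3) * hE + hy
    rw [hY]
    have h1 := hasDerivAt_e (p 0 * p 1 * p 2 * p 3 - p 0 * p 1 - p 0 * p 3 - p 2 * p 3 + 1) c
    have h2 := hasDerivAt_e' (p 0 * p 1 * p 2 * p 3 - p 0 * p 1 - p 0 * p 3 - p 2 * p 3 + 1) c
    fin_cases j
    · refine (h2.const_mul (p 0)).congr_deriv ?_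
      simp [gamma2]; ring
    · refine (h1.const_mul (p 1)).congr_deriv ?_
      simp [gamma2]; ring
    · refine (h2.const_mul (p 2)).congr_deriv ?_
      simp [gamma2]; ring
    · refine (h1.const_mul (p 3)).congr_deriv ?_
      simp [gamma2]; ring
end
end

section
/- Let {·,·} be the bracket on ℂ[x₁, …, x₆] determined as an antisymmetric biderivation by {x₁,x₂} = −3x₁x₂, {x₁,x₃} = −6x₂³ − 3x₁x₃, {x₁,x₄} = 3x₁x₄, {x₁,x₅} = −6x₂²x₄ + 3x₁x₅, {x₁,x₆} = −18x₂²x₅² + 6x₁x₆ − 18x₂x₅ + 6x₃x₄ − 6, {x₂,x₃} = −3x₂x₃, {x₂,x₄} = 3x₂x₄, {x₂,x₅} = 2x₂x₅ − 2x₃x₄ + 2, {x₂,x₆} = −6x₃x₅² + 3x₂x₆, {x₃,x₄} = 6x₃x₄ − 6, {x₃,x₅} = 3x₃x₅, {x₃,x₆} = 3x₃x₆, {x₄,x₅} = −3x₄x₅, {x₄,x₆} = −6x₅³ − 3x₄x₆, {x₅,x₆} = −3x₅x₆, and put y₁ = x₃x₄ − 1. For p = (x₁, …, x₆) ∈ ℂ⁶,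 writing y₁ also for the value y₁(p): if y₁ ≠ 0, the curve γ(c) = (x₁ + x₂³x₄(e^{6cy₁} − 1)/y₁, x₂, x₃e^{−6cy₁}, x₄e^{6cy₁}, x₅, x₆ + x₃x₅³(e^{−6cy₁} − 1)/y₁) satisfies γ(0) = p and γ′(c)_j = {y₁, x_j}(γ(c)) for all c ∈ ℂ and j = 1,…,6; if y₁ = 0, the same holds for the curve γ(c) = (x₁ + 6x₂³x₄c, x₂, x₃, x₄, x₅, x₆ − 6x₃x₅³c). -/
noncomputable section

open MvPolynomial

/-- Coefficients of the standard Poisson bracket on the generalized Bruhat cell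
of `G₂` associated to `(s₂, s₁, s₂, s₂, s₁, s₂)` (variables
`x₁, …, x₆` are `X 0, …, X 5`). -/
def c6 : Fin 6 → Fin 6 → MvPolynomial (Fin 6) ℂ := fun i j =>
  if i = 0 ∧ j = 1 then -3 * X 0 * X 1
  else if i = 0 ∧ j = 2 then -6 * X 1 ^ 3 - 3 * X 0 * X 2
  else if i = 0 ∧ j = 3 then 3 * X 0 * X 3
  else if i = 0 ∧ j = 4 then -6 * X 1 ^ 2 * X 3 + 3 * X 0 * X 4
  else if i = 0 ∧ j = 5 then
    -18 * X 1 ^ 2 * X 4 ^ 2 + 6 * X 0 * X 5 - 18 * X 1 * X 4 + 6 * X 2 * X 3 - 6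
  else if i = 1 ∧ j = 2 then -3 * X 1 * X 2
  else if i = 1 ∧ j = 3 then 3 * X 1 * X 3
  else if i = 1 ∧ j = 4 then 2 * X 1 * X 4 - 2 * X 2 * X 3 + 2
  else if i = 1 ∧ j = 5 then -6 * X 2 * X 4 ^ 2 + 3 * X 1 * X 5
  else if i = 2 ∧ j = 3 then 6 * X 2 * X 3 - 6
  else if i = 2 ∧ j = 4 then 3 * X 2 * X 4
  else if i = 2 ∧ j = 5 then 3 * X 2 * X 5
  else if i = 3 ∧ j = 4 then -3 * X 3 * X 4
  else if i = 3 ∧ j = 5 then -6 * X 4 ^ 3 - 3 * X 3 * X 5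
  else if i = 4 ∧ j = 5 then -3 * X 4 * X 5
  else 0

/-- `y₁ = x₃x₄ - 1`. -/
def y1g : MvPolynomial (Fin 6) ℂ := X 2 * X 3 - 1

/-- The integral curve of `H_{y₁}` through `p` when `y₁(p) ≠ 0`
(here `y₁ = p 2 * p 3 - 1` denotes the value `y₁(p)`). -/
def g2flowB (p : Fin 6 → ℂ) (c : ℂ) : Fin 6 → ℂ :=
  ![p 0 + p 1 ^ 3 * p 3 * (Complex.exp (6 * c * (p 2 * p 3 - 1)) - 1) / (p 2 * p 3 - 1),
    p 1,
    p 2 * Complex.exp (-(6 * c * (p 2 * p 3 - 1))),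
    p 3 * Complex.exp (6 * c * (p 2 * p 3 - 1)),
    p 4,
    p 5 + p 2 * p 4 ^ 3 * (Complex.exp (-(6 * c * (p 2 * p 3 - 1))) - 1) / (p 2 * p 3 - 1)]

/-- The integral curve of `H_{y₁}` through `p` when `y₁(p) = 0`. -/
def g2flowA (p : Fin 6 → ℂ) (c : ℂ) : Fin 6 → ℂ :=
  ![p 0 + 6 * p 1 ^ 3 * p 3 * c, p 1, p 2, p 3, p 4, p 5 - 6 * p 2 * p 4 ^ 3 * c]

/-- The Hamiltonian vector field of `y₁`, evaluated at a point. -/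
theorem eval_bracket (q : Fin 6 → ℂ) (j : Fin 6) :
    MvPolynomial.eval q (pbracket c6 y1g (X j)) =
      ![6 * q 1 ^ 3 * q 3, 0, -6 * q 2 * (q 2 * q 3 - 1), 6 * q 3 * (q 2 * q 3 - 1), 0,
        -6 * q 2 * q 4 ^ 3] j := by
  fin_cases j <;>
  · simp [pbracket, Fin.sum_univ_six, c6, y1g, pderiv_X, Pi.single_apply, Derivation.leibniz]
    try ring

/-- The explicit curves above are the integral curves through `p` of the
Hamiltonian vector field of `y₁ = x₃x₄ - 1` with respect to the `G₂` bracket. -/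
theorem stmt_13 (p : Fin 6 → ℂ) :
    ((p 2 * p 3 - 1 ≠ 0) →
      g2flowB p 0 = p ∧
      ∀ (c : ℂ) (j : Fin 6), HasDerivAt (fun t => g2flowB p t j)
        (MvPolynomial.eval (g2flowB p c) (pbracket c6 y1g (X j))) c) ∧
    ((p 2 * p 3 - 1 = 0) →
      g2flowA p 0 = p ∧
      ∀ (c : ℂ) (j : Fin 6), HasDerivAt (fun t => g2flowA p t j)
        (MvPolynomial.eval (g2flowA p c) (pbracket c6 y1g (X j))) c) := by
  refine ⟨fun h => ⟨?_, fun c j => ?_⟩, fun h => ⟨?_, fun c j => ?_⟩⟩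
  · funext j
    fin_cases j <;> simp [g2flowB]
  · have hl : HasDerivAt (fun t : ℂ => 6 * t * (p 2 * p 3 - 1)) (6 * (p 2 * p 3 - 1)) c := by
      simpa using ((hasDerivAt_id c).const_mul (6 : ℂ)).mul_const (p 2 * p 3 - 1)
    have he := hl.cexp
    have hn := hl.neg.cexp
    have hee : Complex.exp (6 * c * (p 2 * p 3 - 1)) *
        Complex.exp (-(6 * c * (p 2 * p 3 - 1))) = 1 := by
      rw [← Complex.exp_add]; simp
    rw [eval_bracket]
    simp only [Pi.neg_apply] at hn
    fin_cases j
    · refine HasDerivAt.congr_deriv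
        ((((he.sub_const 1).const_mul (p 1 ^ 3 * p 3)).div_const (p 2 * p 3 - 1)).const_add (p 0)) ?_
      simp [g2flowB]
      rw [div_eq_iff h]
      ring
    · exact hasDerivAt_const c (p 1)
    · refine HasDerivAt.congr_deriv (hn.const_mul (p 2)) ?_
      simp [g2flowB]
      linear_combination (-6 * p 2 ^ 2 * p 3 * Complex.exp (-(6 * c * (p 2 * p 3 - 1)))) * hee
    · refine HasDerivAt.congr_deriv (he.const_mul (p 3)) ?_
      simp [g2flowB]
      linear_combination (-6 * p 2 * p 3 ^ 2 * Complex.exp (6 * c * (p 2 * p 3 - 1))) * hee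
    · exact hasDerivAt_const c (p 4)
    · refine HasDerivAt.congr_deriv
        ((((hn.sub_const 1).const_mul (p 2 * p 4 ^ 3)).div_const (p 2 * p 3 - 1)).const_add (p 5)) ?_
      simp [g2flowB]
      rw [div_eq_iff h]
      ring
  · funext j
    fin_cases j <;> simp [g2flowA]
  · rw [eval_bracket]
    fin_cases j
    · refine HasDerivAt.congr_deriv
        (((hasDerivAt_id c).const_mul (6 * p 1 ^ 3 * p 3)).const_add (p 0)) ?_
      simp [g2flowA]
    · exact hasDerivAt_const c (p 1)
    · refine HasDerivAt.congr_deriv (hasDerivAt_const c (p 2)) ?_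
      simp [g2flowA, h]
    · refine HasDerivAt.congr_deriv (hasDerivAt_const c (p 3)) ?_
      simp [g2flowA, h]
    · exact hasDerivAt_const c (p 4)
    · refine HasDerivAt.congr_deriv
        (((hasDerivAt_id c).const_mul (6 * p 2 * p 4 ^ 3)).const_sub (p 5)) ?_
      simp [g2flowA]
end
end

section
/- Let A = (a_{ij}) be a 3×3 complex matrix with det A = 1, and for 1 ≤ i < k ≤ 3 and 1 ≤ j < l ≤ 3 set Δ_{ik,jl} = a_{ij}a_{kl} − a_{il}a_{kj}. Assume a₁₃ ≠ 0, a₃₁ ≠ 0, Δ_{12,23} ≠ 0 and Δ_{23,12} ≠ 0, and define x₁ = Δ_{13,23}/Δ_{12,23}, x₂ = a₃₃/a₁₃, x₃ = a₂₃/a₁₃, x₄ = Δ_{13,12}/Δ_{23,12}, x₅ = Δ_{12,12}/Δ_{23,12}, x₆ = a₂₁/a₃₁. Then x₁x₃x₄x₆ − x₂x₄x₆ − x₁x₆ − x₁x₃x₅ + x₂x₅ + 1 = 1/(a₃₁ Δ_{12,23}) and x₂x₅ − x₃x₄ + 1 = 1/(a₁₃ Δ_{23,12}). -/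
noncomputable section

/-- For a matrix `A ∈ SL(3, ℂ)` in the open double Bruhat cell (i.e. with
`a₁₃, a₃₁, Δ_{12,23}, Δ_{23,12}` all nonzero), the Bott–Samelson coordinates
`x₁, …, x₆` satisfy
`x₁x₃x₄x₆ - x₂x₄x₆ - x₁x₆ - x₁x₃x₅ + x₂x₅ + 1 = 1/(a₃₁ Δ_{12,23})` and
`x₂x₅ - x₃x₄ + 1 = 1/(a₁₃ Δ_{23,12})`.
Indices are 1-based in the paper; here `a_{ij} = A (i-1) (j-1)` and
`Δ_{ik,jl} = a_{ij}a_{kl} - a_{il}a_{kj}`. -/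
theorem stmt_14 (A : Matrix (Fin 3) (Fin 3) ℂ) (hdet : A.det = 1)
    (h13 : A 0 2 ≠ 0) (h31 : A 2 0 ≠ 0)
    (hD1 : A 0 1 * A 1 2 - A 0 2 * A 1 1 ≠ 0)
    (hD2 : A 1 0 * A 2 1 - A 1 1 * A 2 0 ≠ 0)
    (x1 x2 x3 x4 x5 x6 : ℂ)
    (hx1 : x1 = (A 0 1 * A 2 2 - A 0 2 * A 2 1) / (A 0 1 * A 1 2 - A 0 2 * A 1 1))
    (hx2 : x2 = A 2 2 / A 0 2)
    (hx3 : x3 = A 1 2 / A 0 2)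
    (hx4 : x4 = (A 0 0 * A 2 1 - A 0 1 * A 2 0) / (A 1 0 * A 2 1 - A 1 1 * A 2 0))
    (hx5 : x5 = (A 0 0 * A 1 1 - A 0 1 * A 1 0) / (A 1 0 * A 2 1 - A 1 1 * A 2 0))
    (hx6 : x6 = A 1 0 / A 2 0) :
    x1 * x3 * x4 * x6 - x2 * x4 * x6 - x1 * x6 - x1 * x3 * x5 + x2 * x5 + 1
      = 1 / (A 2 0 * (A 0 1 * A 1 2 - A 0 2 * A 1 1)) ∧
    x2 * x5 - x3 * x4 + 1 = 1 / (A 0 2 * (A 1 0 * A 2 1 - A 1 1 * A 2 0)) := by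
  rw [Matrix.det_fin_three] at hdet
  have e1 : x1 * x3 - x2 = (A 1 1 * A 2 2 - A 1 2 * A 2 1) /
      (A 0 1 * A 1 2 - A 0 2 * A 1 1) := by
    rw [hx1, hx2, hx3, div_mul_div_comm, div_sub_div _ _ (mul_ne_zero hD1 h13) h13,
      div_eq_div_iff (mul_ne_zero (mul_ne_zero hD1 h13) h13) hD1]
    ring
  have e2 : x4 * x6 - x5 = A 0 0 / A 2 0 := by
    rw [hx4, hx5, hx6, div_mul_div_comm, div_sub_div _ _ (mul_ne_zero hD2 h31) hD2,
      div_eq_div_iff (mul_ne_zero (mul_ne_zero hD2 h31) hD2) h31]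
    ring
  constructor
  · have e3 : x1 * x3 * x4 * x6 - x2 * x4 * x6 - x1 * x6 - x1 * x3 * x5 + x2 * x5 + 1
        = (x1 * x3 - x2) * (x4 * x6 - x5) - x1 * x6 + 1 := by ring
    rw [e3, e1, e2, hx1, hx6, div_mul_div_comm, div_mul_div_comm, ← sub_div,
      div_add_one (mul_ne_zero hD1 h31), mul_comm (A 2 0)]
    congr 1
    linear_combination hdet
  · rw [hx2, hx3, hx4, hx5, div_mul_div_comm, div_mul_div_comm, ← sub_div,
      div_add_one (mul_ne_zero h13 hD2)]
    congr 1
    linear_combination hdet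
end
end

section
/- Let X = { A = (a_{ij}) ∈ SL(3, ℂ) : a₁₃ a₃₁ Δ_{12,23} Δ_{23,12} ≠ 0 }, where Δ_{ik,jl} = a_{ij}a_{kl} − a_{il}a_{kj}. Define Φ : X → ℂ⁸ by Φ(A) = (a, b, x₁, …, x₆) with a = 1/Δ_{12,23}, b = 1/a₁₃, x₁ = Δ_{13,23}/Δ_{12,23}, x₂ = a₃₃/a₁₃, x₃ = a₂₃/a₁₃, x₄ = Δ_{13,12}/Δ_{23,12}, x₅ = Δ_{12,12}/Δ_{23,12}, x₆ = a₂₁/a₃₁. Then Φ is a bijection from X onto the set { (a, b, x₁, …, x₆) : a ≠ 0, b ≠ 0, y₁(x) ≠ 0, y₂(x) ≠ 0 }, where y₁ = x₁x₃x₄x₆ − x₂x₄x₆ − x₁x₆ − x₁x₃x₅ + x₂x₅ + 1 and y₂ = x₂x₅ − x₃x₄ + 1. -/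
noncomputable section

/-- The open Fomin–Zelevinsky embedding of the double Bruhat cell
`G^{w₀,w₀} ⊂ SL(3, ℂ)` in Bott–Samelson coordinates:
`Φ(A) = (a, b, x₁, …, x₆)` with `a = 1/Δ_{12,23}`, `b = 1/a₁₃`,
`x₁ = Δ_{13,23}/Δ_{12,23}`, `x₂ = a₃₃/a₁₃`, `x₃ = a₂₃/a₁₃`,
`x₄ = Δ_{13,12}/Δ_{23,12}`, `x₅ = Δ_{12,12}/Δ_{23,12}`, `x₆ = a₂₁/a₃₁`.
Indices are 1-based in the paper; here `a_{ij} = A (i-1) (j-1)` and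
`Δ_{ik,jl} = a_{ij}a_{kl} - a_{il}a_{kj}`. -/
def Phi (A : Matrix (Fin 3) (Fin 3) ℂ) : ℂ × ℂ × (Fin 6 → ℂ) :=
  (1 / (A 0 1 * A 1 2 - A 0 2 * A 1 1), 1 / A 0 2,
    ![(A 0 1 * A 2 2 - A 0 2 * A 2 1) / (A 0 1 * A 1 2 - A 0 2 * A 1 1),
      A 2 2 / A 0 2,
      A 1 2 / A 0 2,
      (A 0 0 * A 2 1 - A 0 1 * A 2 0) / (A 1 0 * A 2 1 - A 1 1 * A 2 0),
      (A 0 0 * A 1 1 - A 0 1 * A 1 0) / (A 1 0 * A 2 1 - A 1 1 * A 2 0),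
      A 1 0 / A 2 0])

/-- First denominator polynomial. -/
def yOne (x : Fin 6 → ℂ) : ℂ :=
  x 0 * x 2 * x 3 * x 5 - x 1 * x 3 * x 5 - x 0 * x 5 - x 0 * x 2 * x 4 + x 1 * x 4 + 1

/-- Second denominator polynomial. -/
def yTwo (x : Fin 6 → ℂ) : ℂ := x 1 * x 4 - x 2 * x 3 + 1

/-- The explicit inverse of `Phi`. -/
def Psi (v : ℂ × ℂ × (Fin 6 → ℂ)) : Matrix (Fin 3) (Fin 3) ℂ :=
  let a := v.1
  let b := v.2.1
  let x := v.2.2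
  let k := b / (a * yTwo x)
  !![a / yOne x * (x 3 * x 5 - x 4), k * (x 4 * x 0 - x 3), 1 / b;
     a / yOne x * x 5, k * (x 4 * (x 0 * x 2 - x 1) - 1), x 2 / b;
     a / yOne x, k * (x 3 * (x 0 * x 2 - x 1) - x 0), x 1 / b]

lemma key_y (A : Matrix (Fin 3) (Fin 3) ℂ) (hd : A.det = 1) (h02 : A 0 2 ≠ 0) (h20 : A 2 0 ≠ 0)
    (hD : A 0 1 * A 1 2 - A 0 2 * A 1 1 ≠ 0) (hE : A 1 0 * A 2 1 - A 1 1 * A 2 0 ≠ 0) :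
    yOne (Phi A).2.2 = 1 / (A 2 0 * (A 0 1 * A 1 2 - A 0 2 * A 1 1)) ∧
    yTwo (Phi A).2.2 = 1 / (A 0 2 * (A 1 0 * A 2 1 - A 1 1 * A 2 0)) := by
  rw [Matrix.det_fin_three] at hd
  simp only [yOne, yTwo, Phi, Matrix.cons_val]
  generalize A 0 0 = p at *
  generalize A 0 1 = q at *
  generalize A 0 2 = r at *
  generalize A 1 0 = s at *
  generalize A 1 1 = t at *
  generalize A 1 2 = u at *
  generalize A 2 0 = l at *
  generalize A 2 1 = m at *
  generalize A 2 2 = n at *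
  obtain ⟨D, hDe⟩ : ∃ D, D = q * u - r * t := ⟨_, rfl⟩
  obtain ⟨E, hEe⟩ : ∃ E, E = s * m - t * l := ⟨_, rfl⟩
  rw [← hDe] at hD ⊢
  rw [← hEe] at hE ⊢
  constructor
  · have h1 : (q * n - r * m) / D * (u / r) - n / r = (t * n - u * m) / D := by
      field_simp
      rw [hDe]; ring
    have h2 : (p * m - q * l) / E * (s / l) - (p * t - q * s) / E = p / l := by
      field_simp
      rw [hEe]; ring
    have h3 : p / l * ((t * n - u * m) / D) - (q * n - r * m) / D * (s / l) + 1
        = 1 / (l * D) := by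
      field_simp
      rw [hDe]; linear_combination hd
    rw [← h3, ← h1, ← h2]; ring
  · field_simp
    rw [hEe]; linear_combination hd

lemma key_left (A : Matrix (Fin 3) (Fin 3) ℂ) (hd : A.det = 1) (h02 : A 0 2 ≠ 0)
    (h20 : A 2 0 ≠ 0)
    (hD : A 0 1 * A 1 2 - A 0 2 * A 1 1 ≠ 0) (hE : A 1 0 * A 2 1 - A 1 1 * A 2 0 ≠ 0) :
    Psi (Phi A) = A := by
  obtain ⟨e1, e2⟩ := key_y A hd h02 h20 hD hE
  rw [Matrix.det_fin_three] at hd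
  have hA : A = !![A 0 0, A 0 1, A 0 2; A 1 0, A 1 1, A 1 2; A 2 0, A 2 1, A 2 2] :=
    Matrix.eta_fin_three A
  conv_rhs => rw [hA]
  simp only [Psi, e1, e2]
  clear e1 e2 hA
  simp only [Phi, Matrix.cons_val]
  generalize A 0 0 = p at *
  generalize A 0 1 = q at *
  generalize A 0 2 = r at *
  generalize A 1 0 = s at *
  generalize A 1 1 = t at *
  generalize A 1 2 = u at *
  generalize A 2 0 = l at *
  generalize A 2 1 = m at *
  generalize A 2 2 = n at *
  obtain ⟨D, hDe⟩ : ∃ D, D = q * u - r * t := ⟨_, rfl⟩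
  obtain ⟨E, hEe⟩ : ∃ E, E = s * m - t * l := ⟨_, rfl⟩
  rw [← hDe] at hD ⊢
  rw [← hEe] at hE ⊢
  have h1 : (q * n - r * m) / D * (u / r) - n / r = (t * n - u * m) / D := by
    field_simp
    rw [hDe]; ring
  have h2 : (p * m - q * l) / E * (s / l) - (p * t - q * s) / E = p / l := by
    field_simp
    rw [hEe]; ring
  rw [h1, h2]
  have g1 : 1 / D / (1 / (l * D)) = l := by field_simp
  have g2 : 1 / r / (1 / D * (1 / (r * E))) = D * E := by field_simp
  rw [g1, g2]
  have c1 : l * (p / l) = p := by field_simp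
  have c2 : l * (s / l) = s := by field_simp
  have c3 : D * E * ((p * t - q * s) / E * ((q * n - r * m) / D) - (p * m - q * l) / E) = q := by
    field_simp
    rw [hDe]; linear_combination q * hd
  have c4 : D * E * ((p * t - q * s) / E * ((t * n - u * m) / D) - 1) = t := by
    field_simp
    rw [hDe, hEe]; linear_combination t * hd
  have c5 : D * E * ((p * m - q * l) / E * ((t * n - u * m) / D) - (q * n - r * m) / D) = m := by
    field_simp
    rw [hEe]; linear_combination m * hd
  have c6 : u / r / (1 / r) = u := by field_simp
  have c7 : n / r / (1 / r) = n := by field_simp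
  rw [c1, c2, c3, c4, c5, c6, c7, one_div_one_div]

lemma key_right (a b : ℂ) (x : Fin 6 → ℂ) (ha : a ≠ 0) (hb : b ≠ 0) (h1 : yOne x ≠ 0)
    (h2 : yTwo x ≠ 0) :
    (Psi (a, b, x)).det = 1 ∧ Psi (a, b, x) 0 2 = 1 / b ∧ Psi (a, b, x) 2 0 = a / yOne x ∧
    Psi (a, b, x) 0 1 * Psi (a, b, x) 1 2 - Psi (a, b, x) 0 2 * Psi (a, b, x) 1 1 = 1 / a ∧
    Psi (a, b, x) 1 0 * Psi (a, b, x) 2 1 - Psi (a, b, x) 1 1 * Psi (a, b, x) 2 0 = b / yTwo x ∧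
    Phi (Psi (a, b, x)) = (a, b, x) := by
  have hx : x = ![x 0, x 1, x 2, x 3, x 4, x 5] := by
    ext i; fin_cases i <;> rfl
  have p00 : Psi (a, b, x) 0 0 = a / yOne x * (x 3 * x 5 - x 4) := rfl
  have p01 : Psi (a, b, x) 0 1 = b / (a * yTwo x) * (x 4 * x 0 - x 3) := rfl
  have p02 : Psi (a, b, x) 0 2 = 1 / b := rfl
  have p10 : Psi (a, b, x) 1 0 = a / yOne x * x 5 := rfl
  have p11 : Psi (a, b, x) 1 1 = b / (a * yTwo x) * (x 4 * (x 0 * x 2 - x 1) - 1) := rfl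
  have p12 : Psi (a, b, x) 1 2 = x 2 / b := rfl
  have p20 : Psi (a, b, x) 2 0 = a / yOne x := rfl
  have p21 : Psi (a, b, x) 2 1 = b / (a * yTwo x) * (x 3 * (x 0 * x 2 - x 1) - x 0) := rfl
  have p22 : Psi (a, b, x) 2 2 = x 1 / b := rfl
  have y1 : yOne x = x 0 * x 2 * x 3 * x 5 - x 1 * x 3 * x 5 - x 0 * x 5 - x 0 * x 2 * x 4
    + x 1 * x 4 + 1 := rfl
  have y2 : yTwo x = x 1 * x 4 - x 2 * x 3 + 1 := rfl
  have hD : Psi (a, b, x) 0 1 * Psi (a, b, x) 1 2 - Psi (a, b, x) 0 2 * Psi (a, b, x) 1 1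
      = 1 / a := by
    rw [p01, p12, p02, p11]; field_simp; rw [y2]; ring
  have hD2 : Psi (a, b, x) 0 1 * Psi (a, b, x) 2 2 - Psi (a, b, x) 0 2 * Psi (a, b, x) 2 1
      = x 0 / a := by
    rw [p01, p22, p02, p21]; field_simp; rw [y2]; ring
  have hE : Psi (a, b, x) 1 0 * Psi (a, b, x) 2 1 - Psi (a, b, x) 1 1 * Psi (a, b, x) 2 0
      = b / yTwo x := by
    rw [p10, p21, p11, p20]; field_simp; rw [y1]; ring
  have hE2 : Psi (a, b, x) 0 0 * Psi (a, b, x) 2 1 - Psi (a, b, x) 0 1 * Psi (a, b, x) 2 0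
      = b / yTwo x * x 3 := by
    rw [p00, p21, p01, p20]; field_simp; rw [y1]; ring
  have hE3 : Psi (a, b, x) 0 0 * Psi (a, b, x) 1 1 - Psi (a, b, x) 0 1 * Psi (a, b, x) 1 0
      = b / yTwo x * x 4 := by
    rw [p00, p11, p01, p10]; field_simp; rw [y1]; ring
  have hdet : (Psi (a, b, x)).det = 1 := by
    have : (Psi (a, b, x)).det = 1 / b * (b / yTwo x) - x 2 / b * (b / yTwo x * x 3)
        + x 1 / b * (b / yTwo x * x 4) := by
      rw [← hE3, ← hE2, ← hE, ← p02, ← p12, ← p22, Matrix.det_fin_three]; ring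
    rw [this]; field_simp; rw [y2]; ring
  refine ⟨hdet, p02, p20, hD, hE, ?_⟩
  unfold Phi
  rw [hD, hD2, hE, hE2, hE3, p02, p12, p22, p10, p20]
  have e0 : x 0 / a / (1 / a) = x 0 := by field_simp
  have e1 : x 1 / b / (1 / b) = x 1 := by field_simp
  have e2 : x 2 / b / (1 / b) = x 2 := by field_simp
  have e3 : b / yTwo x * x 3 / (b / yTwo x) = x 3 := by field_simp
  have e4 : b / yTwo x * x 4 / (b / yTwo x) = x 4 := by field_simp
  have e5 : a / yOne x * x 5 / (a / yOne x) = x 5 := by field_simp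
  rw [e0, e1, e2, e3, e4, e5, ← hx, one_div_one_div, one_div_one_div]

/-- `Φ` is a bijection from the open double Bruhat cell
`X = {A ∈ SL(3, ℂ) : a₁₃ a₃₁ Δ_{12,23} Δ_{23,12} ≠ 0}` onto
`{(a, b, x) : a ≠ 0, b ≠ 0, y₁(x) ≠ 0, y₂(x) ≠ 0}`, where
`y₁ = x₁x₃x₄x₆ - x₂x₄x₆ - x₁x₆ - x₁x₃x₅ + x₂x₅ + 1` and
`y₂ = x₂x₅ - x₃x₄ + 1` (with `x₁, …, x₆` being `x 0, …, x 5`). -/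
theorem stmt_15 :
    Set.BijOn Phi
      {A : Matrix (Fin 3) (Fin 3) ℂ | A.det = 1 ∧
        A 0 2 * A 2 0 * (A 0 1 * A 1 2 - A 0 2 * A 1 1)
          * (A 1 0 * A 2 1 - A 1 1 * A 2 0) ≠ 0}
      {v : ℂ × ℂ × (Fin 6 → ℂ) | v.1 ≠ 0 ∧ v.2.1 ≠ 0 ∧
        (v.2.2 0 * v.2.2 2 * v.2.2 3 * v.2.2 5 - v.2.2 1 * v.2.2 3 * v.2.2 5
          - v.2.2 0 * v.2.2 5 - v.2.2 0 * v.2.2 2 * v.2.2 4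
          + v.2.2 1 * v.2.2 4 + 1 ≠ 0) ∧
        (v.2.2 1 * v.2.2 4 - v.2.2 2 * v.2.2 3 + 1 ≠ 0)} := by
  refine Set.InvOn.bijOn (f' := Psi) ⟨?_, ?_⟩ ?_ ?_
  · rintro A ⟨hd, h⟩
    simp only [mul_ne_zero_iff] at h
    obtain ⟨⟨⟨h02, h20⟩, hD⟩, hE⟩ := h
    exact key_left A hd h02 h20 hD hE
  · rintro ⟨a, b, x⟩ ⟨ha, hb, h1, h2⟩
    exact (key_right a b x ha hb h1 h2).2.2.2.2.2
  · rintro A ⟨hd, h⟩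
    simp only [mul_ne_zero_iff] at h
    obtain ⟨⟨⟨h02, h20⟩, hD⟩, hE⟩ := h
    obtain ⟨e1, e2⟩ := key_y A hd h02 h20 hD hE
    refine ⟨one_div_ne_zero hD, one_div_ne_zero h02, ?_, ?_⟩
    · change yOne (Phi A).2.2 ≠ 0
      rw [e1]; exact one_div_ne_zero (mul_ne_zero h20 hD)
    · change yTwo (Phi A).2.2 ≠ 0
      rw [e2]; exact one_div_ne_zero (mul_ne_zero h02 hE)
  · rintro ⟨a, b, x⟩ ⟨ha, hb, h1, h2⟩
    obtain ⟨hd, p02, p20, hD, hE, -⟩ := key_right a b x ha hb h1 h2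
    refine ⟨hd, ?_⟩
    rw [hD, hE, p02, p20]
    exact mul_ne_zero (mul_ne_zero (mul_ne_zero (one_div_ne_zero hb) (div_ne_zero ha h1))
      (one_div_ne_zero ha)) (div_ne_zero hb h2)
end
end
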